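/- arXiv:0808.2081 — 3 statements merged into one kernel-verified Lean document; each statement's English description precedes it below -/
import Mathlib

section
/- Fix a vector of continuous nondecreasing latency functions 𝓛 = (ℓ_e)_{e∈[m]} with ℓ_e: [0,1] → ℝ_{≥0}, ℓ_e(0) = 0 and bounded elasticity, and for n players consider the singleton congestion game with scaled latencies ℓ_e^n(x) = ℓ_e(x/n). If all n players use the Imitation Protocol with uniformly random initialization, then the probability that within poly(n) rounds some link e becomes empty (x_e = 0) is at most 2^{−Ω(n)}. -/
/-!
STATEMENT 9: Fix continuous nondecreasing latency functions `𝓛 = (ℓ_e)` on `[0,1]` with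
`ℓ_e(0) = 0` and bounded elasticity, and scale them as `ℓ_e^n(x) = ℓ_e(x/n)` for a game
with `n` players.  If all players use the Imitation Protocol with uniformly random
initialization, then the probability that within `poly(n)` rounds some link becomes empty
is at most `2^{−Ω(n)}`.
-/

open Finset
open scoped ENNReal

noncomputable section

namespace Stmt9

/-- Number of players on link `e` under the assignment `a`. -/
def counts {m : ℕ} (n : ℕ) (a : Fin n → Fin m) : Fin m → ℕ :=
  fun e => (univ.filter fun i => a i = e).card

/-- Latency of link `e` carrying `k` of the `n` players: the scaled value `ℓ_e(k/n)`. -/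
def lat {m : ℕ} (L : Fin m → ℝ → ℝ) (n : ℕ) (e : Fin m) (k : ℕ) : ℝ :=
  L e ((k : ℝ) / n)

/-- The step size `ν = max_e max_{k∈{1,…,d}} (ℓ_e^n(k) − ℓ_e^n(k−1))` of the Imitation
Protocol for the scaled singleton game. -/
def nu {m : ℕ} (L : Fin m → ℝ → ℝ) (n d : ℕ) (hm : 0 < m) (hd : 1 ≤ d) : ℝ :=
  Finset.univ.sup' ⟨⟨0, hm⟩, Finset.mem_univ _⟩ fun e =>
    (Finset.Icc 1 d).sup' (Finset.nonempty_Icc.mpr hd) fun k =>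
      lat L n e k - lat L n e (k - 1)

/-- Migration probability of the Imitation Protocol: if
`ℓ_e^n(x_e) > ℓ_f^n(x_f+1) + ν`, migrate with probability
`(λ/d)·(ℓ_e^n(x_e) − ℓ_f^n(x_f+1))/ℓ_e^n(x_e)`. -/
def migProb {m : ℕ} (L : Fin m → ℝ → ℝ) (n d : ℕ) (ν lam : ℝ)
    (x : Fin m → ℕ) (e f : Fin m) : ℝ :=
  if lat L n f (x f + 1) + ν < lat L n e (x e) then
    lam / d * ((lat L n e (x e) - lat L n f (x f + 1)) / lat L n e (x e))
  else 0

/-- Marginal distribution of the new link of player `i` in one round of the Imitation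
Protocol. -/
def marginal {m : ℕ} (L : Fin m → ℝ → ℝ) (n d : ℕ) (ν lam : ℝ) (a : Fin n → Fin m)
    (i : Fin n) (f : Fin m) : ℝ :=
  if f = a i then
    1 - ∑ g : Fin m, (counts n a g : ℝ) / n * migProb L n d ν lam (counts n a) (a i) g
  else (counts n a f : ℝ) / n * migProb L n d ν lam (counts n a) (a i) f

/-- Probability that one round of the Imitation Protocol moves the assignment `a` to the
assignment `a'`. -/
def roundProb {m : ℕ} (L : Fin m → ℝ → ℝ) (n d : ℕ) (ν lam : ℝ)
    (a a' : Fin n → Fin m) : ℝ :=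
  ∏ i, marginal L n d ν lam a i (a' i)

open scoped Classical in
/-- `emptyProb T a`: the probability that, starting from assignment `a`, within the first
`T` rounds the dynamics visit a state in which some link is empty. -/
noncomputable def emptyProb {m : ℕ} (L : Fin m → ℝ → ℝ) (n d : ℕ) (ν lam : ℝ) :
    ℕ → (Fin n → Fin m) → ℝ≥0∞
  | 0, a => if ∃ e : Fin m, counts n a e = 0 then 1 else 0
  | T + 1, a =>
      if ∃ e : Fin m, counts n a e = 0 then 1
      else ∑ a' : Fin n → Fin m,
        ENNReal.ofReal (roundProb L n d ν lam a a') * emptyProb L n d ν lam T a'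

section Concentration

variable {m n : ℕ}

lemma sum_counts (a : Fin n → Fin m) : ∑ e, counts n a e = n := by
  have h := Finset.card_eq_sum_card_fiberwise (s := (univ : Finset (Fin n)))
    (t := (univ : Finset (Fin m))) (f := a) (fun _ _ => by simp)
  simpa [counts] using h.symm

/-- If no link is empty and there are at least two links, every link misses some player. -/
lemma counts_lt (hm : 2 ≤ m) {a : Fin n → Fin m} (ha : ∀ e, counts n a e ≠ 0) (e : Fin m) :
    counts n a e < n := by
  have : Nontrivial (Fin m) := Fin.nontrivial_iff_two_le.mpr hm
  obtain ⟨f, hf⟩ := exists_ne e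
  have h := Finset.sum_le_sum_of_subset (f := counts n a) (subset_univ {e, f})
  rw [sum_counts, Finset.sum_pair hf.symm] at h
  have := ha f
  omega

/-- Some link carries at least the average load. -/
lemma exists_average_le_counts (hm : 0 < m) (a : Fin n → Fin m) :
    ∃ g, (n : ℝ) / m ≤ counts n a g := by
  by_contra! h
  have : Nonempty (Fin m) := ⟨⟨0, hm⟩⟩
  have hlt := Finset.sum_lt_sum_of_nonempty univ_nonempty fun g (_ : g ∈ univ) => h g
  rw [← Nat.cast_sum, sum_counts] at hlt
  have hm' : (m : ℝ) ≠ 0 := by positivity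
  simp [mul_div_cancel₀ _ hm'] at hlt

lemma sum_prod_apply (p : Fin n → Fin m → ℝ) :
    ∑ a : Fin n → Fin m, ∏ i, p i (a i) = ∏ i, ∑ f, p i f := by
  rw [Finset.prod_univ_sum, Fintype.piFinset_univ]

/-- Chernoff bound for the lower tail of the load of a link under independent choices. -/
lemma lower_tail {p : Fin n → Fin m → ℝ} (hp : ∀ i f, 0 ≤ p i f) (hp1 : ∀ i, ∑ f, p i f = 1)
    (e : Fin m) {s η : ℝ} (hη : 0 ≤ η) (hη1 : η ≤ 1) (hμ : s + η * n ≤ ∑ i, p i e) :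
    ∑ a : Fin n → Fin m, (∏ i, p i (a i)) * (if (counts n a e : ℝ) < s then 1 else 0) ≤
      Real.exp (-(η ^ 2 * n / 4)) := by
  set θ := η / 2 with hθ
  set q : Fin n → Fin m → ℝ := fun i f => p i f * (if f = e then Real.exp (-θ) else 1) with hq
  have hexp : Real.exp (-θ) ≤ 1 - θ + θ ^ 2 := by
    have h := Real.abs_exp_sub_one_sub_id_le (x := -θ) (by rw [abs_le]; constructor <;> linarith)
    have := (abs_le.mp h).2
    nlinarith
  have hp_le (i : Fin n) : p i e ≤ 1 :=
    (Finset.single_le_sum (fun f _ => hp i f) (mem_univ e)).trans_eq (hp1 i)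
  have hμ_le : ∑ i, p i e ≤ n := by
    simpa using Finset.sum_le_sum fun i (_ : i ∈ univ) => hp_le i
  have hμ0 : 0 ≤ ∑ i, p i e := Finset.sum_nonneg fun i _ => hp i e
  have hprod (a : Fin n → Fin m) :
      ∏ i, q i (a i) = (∏ i, p i (a i)) * Real.exp (-θ * counts n a e) := by
    rw [hq, Finset.prod_mul_distrib, Finset.prod_ite, Finset.prod_const, Finset.prod_const_one,
      mul_one, ← Real.exp_nat_mul, mul_comm (-θ)]
    rfl
  have hsum (i : Fin n) : ∑ f, q i f = 1 - p i e * (1 - Real.exp (-θ)) := by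
    have hqi (f : Fin m) : q i f = p i f - (if f = e then p i f * (1 - Real.exp (-θ)) else 0) := by
      simp only [hq]
      split_ifs <;> ring
    simp only [hqi, Finset.sum_sub_distrib, hp1, Finset.sum_ite_eq', mem_univ, if_true]
  calc ∑ a : Fin n → Fin m, (∏ i, p i (a i)) * (if (counts n a e : ℝ) < s then 1 else 0)
      ≤ ∑ a : Fin n → Fin m, Real.exp (θ * s) * ∏ i, q i (a i) := by
        refine Finset.sum_le_sum fun a _ => ?_
        rw [hprod, mul_left_comm, ← Real.exp_add]
        refine mul_le_mul_of_nonneg_left ?_ (Finset.prod_nonneg fun i _ => hp i _)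
        split_ifs with h
        · refine Real.one_le_exp ?_
          nlinarith
        · positivity
    _ = Real.exp (θ * s) * ∏ i, (1 - p i e * (1 - Real.exp (-θ))) := by
        rw [← Finset.mul_sum, sum_prod_apply]
        simp only [hsum]
    _ ≤ Real.exp (θ * s) * ∏ i, Real.exp (-(p i e * (1 - Real.exp (-θ)))) := by
        refine mul_le_mul_of_nonneg_left (Finset.prod_le_prod (fun i _ => ?_) fun i _ => ?_)
          (Real.exp_pos _).le
        · have := Real.exp_pos (-θ)
          nlinarith [hp_le i, hp i e]
        · have := Real.add_one_le_exp (-(p i e * (1 - Real.exp (-θ))))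
          linarith
    _ = Real.exp (θ * s - (∑ i, p i e) * (1 - Real.exp (-θ))) := by
        rw [← Real.exp_sum, ← Real.exp_add, Finset.sum_neg_distrib, ← Finset.sum_mul,
          ← sub_eq_add_neg]
    _ ≤ Real.exp (-(η ^ 2 * n / 4)) := by
        refine Real.exp_le_exp.mpr ?_
        have h1 : (∑ i, p i e) * (θ - θ ^ 2) ≤ (∑ i, p i e) * (1 - Real.exp (-θ)) :=
          mul_le_mul_of_nonneg_left (by linarith) hμ0
        have h2 : θ * (s + η * n) ≤ θ * ∑ i, p i e := mul_le_mul_of_nonneg_left hμ (by positivity)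
        have h3 : θ ^ 2 * ∑ i, p i e ≤ θ ^ 2 * n := mul_le_mul_of_nonneg_left hμ_le (by positivity)
        have h4 : θ ^ 2 * n - θ * (η * n) = -(η ^ 2 * n / 4) := by rw [hθ]; ring
        nlinarith

/-- A bounded function that is at most `C` whenever all links carry at least `s` players has
expectation at most `C` plus the tail bounds of the individual links. -/
lemma expectation_le {p : Fin n → Fin m → ℝ} (hp : ∀ i f, 0 ≤ p i f)
    (hp1 : ∀ i, ∑ f, p i f = 1) {s η : ℝ} (hη : 0 ≤ η) (hη1 : η ≤ 1)
    (hμ : ∀ e, s + η * n ≤ ∑ i, p i e) {h : (Fin n → Fin m) → ℝ≥0∞} {C : ℝ≥0∞}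
    (h1 : ∀ a, h a ≤ 1) (hC : ∀ a, (∀ e, s ≤ counts n a e) → h a ≤ C) :
    ∑ a : Fin n → Fin m, ENNReal.ofReal (∏ i, p i (a i)) * h a ≤
      m * ENNReal.ofReal (Real.exp (-(η ^ 2 * n / 4))) + C := by
  have hw (a : Fin n → Fin m) : 0 ≤ ∏ i, p i (a i) := Finset.prod_nonneg fun i _ => hp i _
  have hbound (a : Fin n → Fin m) :
      h a ≤ (∑ e, ENNReal.ofReal (if (counts n a e : ℝ) < s then 1 else 0)) + C := by
    by_cases ha : ∀ e, s ≤ counts n a e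
    · exact (hC a ha).trans le_add_self
    · push Not at ha
      obtain ⟨e, he⟩ := ha
      refine (h1 a).trans (le_trans ?_ le_self_add)
      refine le_trans ?_ (Finset.single_le_sum (fun _ _ => zero_le) (mem_univ e))
      simp [he]
  have htail (e : Fin m) : ∑ a : Fin n → Fin m, ENNReal.ofReal (∏ i, p i (a i)) *
      ENNReal.ofReal (if (counts n a e : ℝ) < s then 1 else 0) ≤
        ENNReal.ofReal (Real.exp (-(η ^ 2 * n / 4))) := by
    simp_rw [← ENNReal.ofReal_mul (hw _)]
    rw [← ENNReal.ofReal_sum_of_nonneg fun a _ => mul_nonneg (hw a) (by split_ifs <;> norm_num)]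
    exact ENNReal.ofReal_le_ofReal (lower_tail hp hp1 e hη hη1 (hμ e))
  have hmass : ∑ a : Fin n → Fin m, ENNReal.ofReal (∏ i, p i (a i)) = 1 := by
    rw [← ENNReal.ofReal_sum_of_nonneg fun a _ => hw a, sum_prod_apply]
    simp [hp1]
  calc ∑ a : Fin n → Fin m, ENNReal.ofReal (∏ i, p i (a i)) * h a
      ≤ ∑ a : Fin n → Fin m, ENNReal.ofReal (∏ i, p i (a i)) *
          ((∑ e, ENNReal.ofReal (if (counts n a e : ℝ) < s then 1 else 0)) + C) :=
        Finset.sum_le_sum fun a _ => mul_le_mul_right (hbound a) _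
    _ = (∑ e, ∑ a : Fin n → Fin m, ENNReal.ofReal (∏ i, p i (a i)) *
          ENNReal.ofReal (if (counts n a e : ℝ) < s then 1 else 0)) + C := by
        simp_rw [mul_add, Finset.sum_add_distrib, ← Finset.sum_mul, hmass, one_mul, Finset.mul_sum]
        rw [Finset.sum_comm]
    _ ≤ (∑ _e : Fin m, ENNReal.ofReal (Real.exp (-(η ^ 2 * n / 4)))) + C := by
        gcongr with e
        exact htail e
    _ = m * ENNReal.ofReal (Real.exp (-(η ^ 2 * n / 4))) + C := by simp

end Concentration

section Latency

variable {m n d : ℕ} {L : Fin m → ℝ → ℝ} {ν lam : ℝ}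

lemma div_mem_Icc {k : ℕ} (hk : k ≤ n) : (k : ℝ) / n ∈ Set.Icc (0 : ℝ) 1 :=
  ⟨by positivity, div_le_one_of_le₀ (by exact_mod_cast hk) (by positivity)⟩

lemma lat_mono (hmono : ∀ e, MonotoneOn (L e) (Set.Icc 0 1)) (e : Fin m) {j k : ℕ} (hjk : j ≤ k)
    (hk : k ≤ n) : lat L n e j ≤ lat L n e k :=
  hmono e (div_mem_Icc (hjk.trans hk)) (div_mem_Icc hk) (by gcongr)

lemma lat_nonneg (hmono : ∀ e, MonotoneOn (L e) (Set.Icc 0 1)) (hzero : ∀ e, L e 0 = 0)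
    (e : Fin m) {k : ℕ} (hk : k ≤ n) : 0 ≤ lat L n e k := by
  simpa [lat, hzero] using lat_mono hmono e (Nat.zero_le k) hk

lemma nu_nonneg (hmono : ∀ e, MonotoneOn (L e) (Set.Icc 0 1)) (hm : 0 < m) (hd : 1 ≤ d)
    (hn : d ≤ n) : 0 ≤ nu L n d hm hd := by
  refine le_trans ?_ (Finset.le_sup' _ (mem_univ (⟨0, hm⟩ : Fin m)))
  refine le_trans ?_ (Finset.le_sup' _ (Finset.mem_Icc.mpr ⟨le_rfl, hd⟩))
  exact sub_nonneg.mpr (lat_mono hmono _ (Nat.sub_le 1 1) (hd.trans hn))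

lemma nu_le (hmono : ∀ e, MonotoneOn (L e) (Set.Icc 0 1)) (hzero : ∀ e, L e 0 = 0) (hm : 0 < m)
    (hd : 1 ≤ d) (hn : d ≤ n) {C : ℝ} (hC : ∀ e, lat L n e d ≤ C) : nu L n d hm hd ≤ C := by
  refine Finset.sup'_le _ _ fun e _ => Finset.sup'_le _ _ fun k hk => ?_
  have hk := (Finset.mem_Icc.mp hk).2
  have h0 := lat_nonneg hmono hzero e ((Nat.sub_le k 1).trans (hk.trans hn))
  have h1 := lat_mono hmono e hk hn
  linarith [hC e]

lemma migProb_self (hmono : ∀ e, MonotoneOn (L e) (Set.Icc 0 1)) (hν : 0 ≤ ν) {x : Fin m → ℕ}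
    {e : Fin m} (hx : x e < n) : migProb L n d ν lam x e e = 0 := by
  refine if_neg (not_lt.mpr ?_)
  linarith [lat_mono hmono e (Nat.le_succ (x e)) hx]

lemma migProb_nonneg (hmono : ∀ e, MonotoneOn (L e) (Set.Icc 0 1)) (hzero : ∀ e, L e 0 = 0)
    (hν : 0 ≤ ν) (hlam : 0 ≤ lam) {x : Fin m → ℕ} {e f : Fin m} (he : x e ≤ n) :
    0 ≤ migProb L n d ν lam x e f := by
  unfold migProb
  have h0 := lat_nonneg hmono hzero e he
  split_ifs with h
  · have : 0 ≤ lat L n e (x e) - lat L n f (x f + 1) := by linarith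
    positivity
  · exact le_rfl

lemma migProb_le (hmono : ∀ e, MonotoneOn (L e) (Set.Icc 0 1)) (hzero : ∀ e, L e 0 = 0)
    (hlam : 0 ≤ lam) {x : Fin m → ℕ} {e f : Fin m} (he : x e ≤ n) (hf : x f < n) :
    migProb L n d ν lam x e f ≤ lam / d := by
  unfold migProb
  have h0 := lat_nonneg hmono hzero e he
  have h1 := lat_nonneg hmono hzero f hf
  split_ifs with h
  · refine mul_le_of_le_one_right (by positivity) (div_le_one_of_le₀ (by linarith) h0)
  · positivity

end Latency

section Dynamics

variable {m n d : ℕ} {L : Fin m → ℝ → ℝ} {ν lam : ℝ}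

/-- Probability that a player on link `e` leaves it in one round. -/
def leaveProb (L : Fin m → ℝ → ℝ) (n d : ℕ) (ν lam : ℝ) (a : Fin n → Fin m) (e : Fin m) : ℝ :=
  ∑ g : Fin m, (counts n a g : ℝ) / n * migProb L n d ν lam (counts n a) e g

lemma leaveProb_le (hmono : ∀ e, MonotoneOn (L e) (Set.Icc 0 1)) (hzero : ∀ e, L e 0 = 0)
    (hlam : 0 ≤ lam) {a : Fin n → Fin m} (ha : ∀ e, counts n a e < n) (e : Fin m) :
    leaveProb L n d ν lam a e ≤ lam / d := by
  calc leaveProb L n d ν lam a e ≤ ∑ g : Fin m, (counts n a g : ℝ) / n * (lam / d) :=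
        Finset.sum_le_sum fun g _ => mul_le_mul_of_nonneg_left
          (migProb_le hmono hzero hlam (ha e).le (ha g)) (by positivity)
    _ = (n : ℝ) / n * (lam / d) := by
        rw [← Finset.sum_mul, ← Finset.sum_div, ← Nat.cast_sum, sum_counts]
    _ ≤ lam / d := mul_le_of_le_one_left (by positivity) (div_self_le_one _)

lemma lam_div_le (hd : 1 ≤ d) (hlam : 0 ≤ lam) : lam / d ≤ lam :=
  div_le_self hlam (by exact_mod_cast hd)

lemma marginal_nonneg (hmono : ∀ e, MonotoneOn (L e) (Set.Icc 0 1)) (hzero : ∀ e, L e 0 = 0)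
    (hν : 0 ≤ ν) (hlam : 0 ≤ lam) (hlam1 : lam ≤ 1) (hd : 1 ≤ d) {a : Fin n → Fin m}
    (ha : ∀ e, counts n a e < n) (i : Fin n) (f : Fin m) : 0 ≤ marginal L n d ν lam a i f := by
  unfold marginal
  split_ifs
  · have h := leaveProb_le (d := d) (ν := ν) hmono hzero hlam ha (a i)
    unfold leaveProb at h
    linarith [lam_div_le hd hlam]
  · exact mul_nonneg (by positivity) (migProb_nonneg hmono hzero hν hlam (ha _).le)

lemma sum_marginal (hmono : ∀ e, MonotoneOn (L e) (Set.Icc 0 1)) (hν : 0 ≤ ν)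
    {a : Fin n → Fin m} (ha : ∀ e, counts n a e < n) (i : Fin n) :
    ∑ f, marginal L n d ν lam a i f = 1 := by
  have h (f : Fin m) : marginal L n d ν lam a i f =
      (counts n a f : ℝ) / n * migProb L n d ν lam (counts n a) (a i) f +
        if f = a i then 1 - leaveProb L n d ν lam a (a i) else 0 := by
    unfold marginal leaveProb
    split_ifs with hf
    · rw [hf, migProb_self hmono hν (ha _)]
      ring
    · ring
  simp only [h, Finset.sum_add_distrib, Finset.sum_ite_eq', mem_univ, if_true, leaveProb]
  ring

/-- Expected load of link `e` after one round: the players that stay, plus those that arrive from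
some other link `g`, at least. -/
lemma expected_load_ge_of_stay (hmono : ∀ e, MonotoneOn (L e) (Set.Icc 0 1))
    (hzero : ∀ e, L e 0 = 0) (hν : 0 ≤ ν) (hlam : 0 ≤ lam) {a : Fin n → Fin m}
    (ha : ∀ e, counts n a e < n) {e g : Fin m} (hge : g ≠ e) :
    counts n a e * (1 - leaveProb L n d ν lam a e) +
        counts n a g * ((counts n a e : ℝ) / n * migProb L n d ν lam (counts n a) g e) ≤
      ∑ i, marginal L n d ν lam a i e := by
  have hterm (i : Fin n) : (if a i = e then 1 - leaveProb L n d ν lam a e else 0) +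
      (if a i = g then (counts n a e : ℝ) / n * migProb L n d ν lam (counts n a) g e else 0) ≤
        marginal L n d ν lam a i e := by
    unfold marginal leaveProb
    by_cases he : a i = e
    · subst he
      simp [hge.symm]
    · rw [if_neg he, if_neg (Ne.symm he), zero_add]
      split_ifs with hg
      · rw [hg]
      · exact mul_nonneg (by positivity) (migProb_nonneg hmono hzero hν hlam (ha _).le)
  refine le_trans (le_of_eq ?_) (Finset.sum_le_sum fun i _ => hterm i)
  rw [Finset.sum_add_distrib, ← Finset.sum_filter, ← Finset.sum_filter]
  simp only [Finset.sum_const, nsmul_eq_mul, counts]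

/-- If every link carries at least a `δ` fraction of the players, the expected load of each link
after one round exceeds `δ * n` by a linear margin. -/
lemma expected_load_ge (hmono : ∀ e, MonotoneOn (L e) (Set.Icc 0 1)) (hzero : ∀ e, L e 0 = 0)
    (hν : 0 ≤ ν) (hlam : 0 ≤ lam) (hlam1 : lam ≤ 1 / 4) (hm : 2 ≤ m) (hd : 1 ≤ d) {c δ : ℝ}
    (hc : 0 < c) (hLc : ∀ e, c ≤ L e (1 / (8 * m ^ 2))) (hδ : 0 < δ)
    (hδm : 4 * δ ≤ 1 / (8 * m ^ 2)) (hLδ : ∀ e, L e (4 * δ) ≤ c / 4) (hνc : ν ≤ c / 4)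
    (hn : 1 ≤ δ * n) {a : Fin n → Fin m} (hgood : ∀ e, δ * n ≤ counts n a e) (e : Fin m) :
    δ * n + δ * lam / (4 * d * m) * n ≤ ∑ i, marginal L n d ν lam a i e := by
  have hn0 : (0 : ℝ) < n := by
    by_contra! h
    nlinarith
  have ha : ∀ e, counts n a e < n := counts_lt hm fun e h => by
    have := hgood e
    rw [h, Nat.cast_zero] at this
    linarith
  have hm0 : (2 : ℝ) ≤ m := by exact_mod_cast hm
  have hd0 : (1 : ℝ) ≤ d := by exact_mod_cast hd
  have hw1 : 1 / (8 * (m : ℝ) ^ 2) ≤ 1 / m := by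
    refine one_div_le_one_div_of_le (by positivity) (by nlinarith)
  have hm1 : 1 / (m : ℝ) ≤ 1 := (div_le_one (by positivity)).mpr (by linarith)
  have hw : 1 / (8 * (m : ℝ) ^ 2) ∈ Set.Icc (0 : ℝ) 1 := ⟨by positivity, by linarith⟩
  obtain ⟨κ, hκ⟩ : ∃ κ : ℝ, κ = lam / d := ⟨_, rfl⟩
  have hκ0 : 0 ≤ κ := by rw [hκ]; positivity
  have hκ1 : κ ≤ 1 / 4 := hκ ▸ (lam_div_le hd hlam).trans hlam1
  have hgoal : δ * n + δ * lam / (4 * d * m) * n = δ * n * (1 + κ * (1 / m) / 4) := by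
    rw [hκ]; field_simp
  rw [hgoal]
  have hκm : κ * (1 / m) ≤ 1 / 4 := (mul_le_of_le_one_right hκ0 hm1).trans hκ1
  have hκm0 : 0 ≤ κ * (1 / m) := by positivity
  obtain hlarge | hsmall := le_total (2 * δ * n) (counts n a e)
  · have : Nontrivial (Fin m) := Fin.nontrivial_iff_two_le.mpr hm
    obtain ⟨g, hg⟩ := exists_ne e
    have hload := expected_load_ge_of_stay (d := d) hmono hzero hν hlam ha hg
    have harr : 0 ≤ (counts n a g : ℝ) *
        ((counts n a e : ℝ) / n * migProb L n d ν lam (counts n a) g e) :=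
      mul_nonneg (by positivity) (mul_nonneg (by positivity)
        (migProb_nonneg hmono hzero hν hlam (ha _).le))
    have hleave := leaveProb_le (d := d) (ν := ν) hmono hzero hlam ha e
    rw [← hκ] at hleave
    have h1 : (counts n a e : ℝ) * (3 / 4) ≤
        counts n a e * (1 - leaveProb L n d ν lam a e) :=
      mul_le_mul_of_nonneg_left (by linarith) (by positivity)
    have h2 : δ * n * (1 + κ * (1 / m) / 4) ≤ δ * n * (3 / 2) :=
      mul_le_mul_of_nonneg_left (by linarith) (by positivity)
    linarith
  · obtain ⟨g, hg⟩ := exists_average_le_counts (by omega) a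
    have hlat_e : lat L n e (counts n a e + 1) ≤ c / 4 := by
      refine (hmono e (div_mem_Icc (ha e)) ⟨by positivity, by linarith⟩ ?_).trans (hLδ e)
      rw [div_le_iff₀ hn0]
      push_cast
      linarith
    have hlat_g : c ≤ lat L n g (counts n a g) := by
      refine (hLc g).trans (hmono g hw (div_mem_Icc (ha g).le) ?_)
      rw [le_div_iff₀ hn0]
      refine le_trans ?_ hg
      rw [div_eq_mul_one_div (n : ℝ), mul_comm]
      exact mul_le_mul_of_nonneg_left hw1 hn0.le
    have hlat_e' : lat L n e (counts n a e) ≤ c / 4 :=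
      (lat_mono hmono e (Nat.le_succ _) (ha e)).trans hlat_e
    have hge : g ≠ e := by
      rintro rfl
      linarith
    have harr : κ / 2 ≤ migProb L n d ν lam (counts n a) g e := by
      unfold migProb
      rw [if_pos (by linarith), ← hκ, div_eq_mul_one_div]
      refine mul_le_mul_of_nonneg_left ?_ hκ0
      rw [le_div_iff₀ (by linarith)]
      linarith
    have hleave : leaveProb L n d ν lam a e ≤ κ * (1 / m) / 8 := by
      have hterm (f : Fin m) : (counts n a f : ℝ) / n * migProb L n d ν lam (counts n a) e f ≤
          1 / (8 * m ^ 2) * κ := by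
        by_cases hf : lat L n f (counts n a f + 1) + ν < lat L n e (counts n a e)
        · refine mul_le_mul ?_ (hκ ▸ migProb_le hmono hzero hlam (ha e).le (ha f))
            (migProb_nonneg hmono hzero hν hlam (ha e).le) (by positivity)
          by_contra! hlt
          have h1 : L f (1 / (8 * m ^ 2)) ≤ lat L n f (counts n a f) :=
            hmono f hw (div_mem_Icc (ha f).le) hlt.le
          have h2 := lat_mono hmono f (Nat.le_succ (counts n a f)) (ha f)
          linarith [hLc f]
        · rw [migProb, if_neg hf, mul_zero]
          positivity
      refine (Finset.sum_le_sum fun f _ => hterm f).trans_eq ?_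
      rw [Finset.sum_const, card_univ, Fintype.card_fin, nsmul_eq_mul]
      field_simp
    have hflow : (counts n a e : ℝ) * (κ * (1 / m) / 2) ≤
        counts n a g * ((counts n a e : ℝ) / n * migProb L n d ν lam (counts n a) g e) := by
      have h1 : (n : ℝ) / m * ((counts n a e : ℝ) / n * (κ / 2)) ≤
          counts n a g * ((counts n a e : ℝ) / n * migProb L n d ν lam (counts n a) g e) := by
        gcongr
      refine le_trans (le_of_eq ?_) h1
      field_simp
    have hload := expected_load_ge_of_stay (d := d) hmono hzero hν hlam ha hge
    have hstay : (counts n a e : ℝ) * (1 - κ * (1 / m) / 8) ≤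
        counts n a e * (1 - leaveProb L n d ν lam a e) :=
      mul_le_mul_of_nonneg_left (by linarith) (by positivity)
    have hfinal : δ * n * (1 + κ * (1 / m) / 4) ≤ counts n a e * (1 + κ * (1 / m) / 4) :=
      mul_le_mul_of_nonneg_right (hgood e) (by linarith)
    nlinarith [mul_nonneg (Nat.cast_nonneg (α := ℝ) (counts n a e)) hκm0]

lemma emptyProb_le_one (hmono : ∀ e, MonotoneOn (L e) (Set.Icc 0 1)) (hzero : ∀ e, L e 0 = 0)
    (hν : 0 ≤ ν) (hlam : 0 ≤ lam) (hlam1 : lam ≤ 1) (hm : 2 ≤ m) (hd : 1 ≤ d) (T : ℕ)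
    (a : Fin n → Fin m) : emptyProb L n d ν lam T a ≤ 1 := by
  induction T generalizing a with
  | zero => unfold emptyProb; split_ifs <;> simp
  | succ T ih =>
    unfold emptyProb
    split_ifs with h
    · exact le_rfl
    · have ha := counts_lt hm (not_exists.mp h)
      have hp := marginal_nonneg hmono hzero hν hlam hlam1 hd ha
      calc _ ≤ ∑ a', ENNReal.ofReal (roundProb L n d ν lam a a') :=
            Finset.sum_le_sum fun a' _ => mul_le_of_le_one_right' (ih a')
        _ = 1 := by
            unfold roundProb
            rw [← ENNReal.ofReal_sum_of_nonneg fun a' _ => Finset.prod_nonneg fun i _ => hp i _,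
              sum_prod_apply]
            simp [sum_marginal hmono hν ha]

lemma emptyProb_le (hmono : ∀ e, MonotoneOn (L e) (Set.Icc 0 1)) (hzero : ∀ e, L e 0 = 0)
    (hν : 0 ≤ ν) (hlam : 0 ≤ lam) (hlam1 : lam ≤ 1) (hm : 2 ≤ m) (hd : 1 ≤ d) {s η : ℝ}
    (hs : 0 < s) (hη : 0 ≤ η) (hη1 : η ≤ 1)
    (hdrift : ∀ a : Fin n → Fin m, (∀ e, s ≤ counts n a e) →
      ∀ e, s + η * n ≤ ∑ i, marginal L n d ν lam a i e)
    (T : ℕ) (a : Fin n → Fin m) (hgood : ∀ e, s ≤ counts n a e) :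
    emptyProb L n d ν lam T a ≤ T * (m * ENNReal.ofReal (Real.exp (-(η ^ 2 * n / 4)))) := by
  induction T generalizing a with
  | zero =>
    have h : ¬ ∃ e, counts n a e = 0 := fun ⟨e, he⟩ => by
      have := hgood e
      rw [he, Nat.cast_zero] at this
      linarith
    simp [emptyProb, h]
  | succ T ih =>
    have h : ¬ ∃ e, counts n a e = 0 := fun ⟨e, he⟩ => by
      have := hgood e
      rw [he, Nat.cast_zero] at this
      linarith
    have ha := counts_lt hm (not_exists.mp h)
    unfold emptyProb
    rw [if_neg h]
    refine (expectation_le (marginal_nonneg hmono hzero hν hlam hlam1 hd ha)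
      (sum_marginal hmono hν ha) hη hη1 (hdrift a hgood)
      (emptyProb_le_one hmono hzero hν hlam hlam1 hm hd T) ih).trans_eq ?_
    push_cast
    ring

lemma emptyProb_eq_zero (h : ∀ (a : Fin n → Fin m) e, counts n a e ≠ 0) (T : ℕ)
    (a : Fin n → Fin m) : emptyProb L n d ν lam T a = 0 := by
  induction T generalizing a with
  | zero => simp [emptyProb, h]
  | succ T ih => simp [emptyProb, h, ih]

end Dynamics

/-- A polynomial number of exponentially small failure probabilities stays exponentially small. -/
lemma eventually_poly_mul_exp_le (m K : ℕ) {b : ℝ} (hb : 0 < b) :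
    ∀ᶠ n : ℕ in Filter.atTop,
      ((n : ℝ) ^ K + 1) * (m * Real.exp (-(2 * b * n))) ≤ Real.exp (-(b * n)) := by
  have hlim (k : ℕ) : Filter.Tendsto (fun n : ℕ => (n : ℝ) ^ k * Real.exp (-b * n))
      Filter.atTop (nhds 0) := by
    simpa [Function.comp_def] using
      (tendsto_rpow_mul_exp_neg_mul_atTop_nhds_zero k b hb).comp tendsto_natCast_atTop_atTop
  have h := (((hlim K).add (hlim 0)).mul_const (m : ℝ)).eventually_le_const
    (show (0 + 0) * (m : ℝ) < 1 by norm_num)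
  filter_upwards [h] with n hn
  have hsplit : Real.exp (-(2 * b * n)) = Real.exp (-b * n) * Real.exp (-(b * n)) := by
    rw [← Real.exp_add]; congr 1; ring
  calc _ = (((n : ℝ) ^ K * Real.exp (-b * n) + (n : ℝ) ^ 0 * Real.exp (-b * n)) * m) *
        Real.exp (-(b * n)) := by rw [hsplit]; ring
    _ ≤ Real.exp (-(b * n)) := mul_le_of_le_one_left (Real.exp_pos _).le hn

/-- All latencies are simultaneously small near zero. -/
lemma exists_small_argument {m : ℕ} {L : Fin m → ℝ → ℝ}
    (hcont : ∀ e, ContinuousOn (L e) (Set.Icc 0 1)) (hzero : ∀ e, L e 0 = 0) {w c : ℝ}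
    (hw : 0 < w) (hc : 0 < c) : ∃ u, 0 < u ∧ u ≤ w ∧ ∀ e, L e u ≤ c := by
  have hL : ∀ᶠ u in nhdsWithin (0 : ℝ) (Set.Ioi 0), ∀ e, L e u ≤ c := by
    refine Filter.eventually_all.mpr fun e => ?_
    have h := (hcont e 0 ⟨le_rfl, zero_le_one⟩).tendsto
    rw [hzero e] at h
    exact (h.eventually_le_const hc).filter_mono
      (nhdsWithin_le_iff.mpr (Icc_mem_nhdsGT zero_lt_one))
  obtain ⟨u, hu, hu'⟩ := (hL.and (Ioc_mem_nhdsGT hw)).exists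
  exact ⟨u, hu'.1, hu'.2, hu⟩

/-- There is a constant `λ₀ > 0` such that the following holds.  Fix a
vector `𝓛 = (ℓ_e)_{e∈[m]}` of continuous nondecreasing latency functions on `[0,1]` with
`ℓ_e(0) = 0`, positive on `(0,1]`, of elasticity at most `d` on `(0,1]`, and fix
`λ ∈ (0,λ₀]` and a polynomial exponent `K`.  Then there are `γ > 0` and `n₀` such that for
every `n ≥ n₀`, in the singleton game with `n` players and latencies `ℓ_e^n(x) = ℓ_e(x/n)`,
the probability that the Imitation Protocol, started from a uniformly random
initialization, generates within `n^K` rounds a state with `x_e = 0` for some link `e`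
is at most `2^{−γ·n}`. -/
theorem no_link_becomes_empty :
    ∃ lam0 : ℝ, 0 < lam0 ∧
      ∀ (m : ℕ) (hm : 0 < m) (L : Fin m → ℝ → ℝ) (d : ℕ) (hd : 1 ≤ d) (lam : ℝ),
        (∀ e, ContinuousOn (L e) (Set.Icc 0 1)) →
        (∀ e, MonotoneOn (L e) (Set.Icc 0 1)) →
        (∀ e, L e 0 = 0) →
        (∀ e (y : ℝ), 0 < y → y ≤ 1 → 0 < L e y) →
        (∀ e (y : ℝ), 0 < y → y ≤ 1 → DifferentiableAt ℝ (L e) y) →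
        (∀ e (y : ℝ), 0 < y → y ≤ 1 → deriv (L e) y * y ≤ d * L e y) →
        0 < lam → lam ≤ lam0 →
        ∀ K : ℕ, ∃ γ : ℝ, 0 < γ ∧ ∃ n₀ : ℕ, ∀ n : ℕ, n₀ ≤ n →
          (∑ a : Fin n → Fin m, ENNReal.ofReal (1 / (m : ℝ) ^ n) *
              emptyProb L n d (nu L n d hm hd) lam (n ^ K) a) ≤
            ENNReal.ofReal ((2 : ℝ) ^ (-(γ * n))) := by
  refine ⟨1 / 4, by norm_num, ?_⟩
  intro m hm L d hd lam hcont hmono hzero hpos _ _ hlam hlam1 K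
  have : Nonempty (Fin m) := ⟨⟨0, hm⟩⟩
  obtain rfl | hm2 : m = 1 ∨ 2 ≤ m := by omega
  · refine ⟨1, one_pos, 1, fun n hn => ?_⟩
    have hne (a : Fin n → Fin 1) (e : Fin 1) : counts n a e ≠ 0 := by
      have h := sum_counts a
      rw [Fin.sum_univ_one, Subsingleton.elim 0 e] at h
      omega
    simp [emptyProb_eq_zero hne]
  have hm0 : (2 : ℝ) ≤ m := by exact_mod_cast hm2
  have hd0 : (1 : ℝ) ≤ d := by exact_mod_cast hd
  have hw : 0 < 1 / (8 * (m : ℝ) ^ 2) := by positivity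
  have hwm : 1 / (8 * (m : ℝ) ^ 2) ≤ 1 / m :=
    one_div_le_one_div_of_le (by positivity) (by nlinarith)
  have hm1 : 1 / (m : ℝ) ≤ 1 := (div_le_one (by positivity)).mpr (by linarith)
  obtain ⟨e₀, he₀⟩ := Finite.exists_min fun e => L e (1 / (8 * (m : ℝ) ^ 2))
  have hc := hpos e₀ _ hw (hwm.trans hm1)
  obtain ⟨u, hu0, huw, hLu⟩ := exists_small_argument hcont hzero hw
    (show 0 < L e₀ (1 / (8 * (m : ℝ) ^ 2)) / 4 by positivity)
  obtain ⟨δ, rfl⟩ : ∃ δ, u = 4 * δ := ⟨u / 4, by ring⟩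
  have hδ : 0 < δ := by linarith
  set η := δ * lam / (4 * d * m) with hη
  have hη0 : 0 < η := by positivity
  have hηδ : η ≤ δ := by
    rw [hη, div_le_iff₀ (by positivity)]
    refine mul_le_mul_of_nonneg_left ?_ hδ.le
    nlinarith
  obtain ⟨N, hN⟩ := Filter.eventually_atTop.mp
    (eventually_poly_mul_exp_le m K (b := η ^ 2 / 8) (by positivity))
  refine ⟨η ^ 2 / 8 / Real.log 2, by have := Real.log_pos one_lt_two; positivity,
    max N ⌈d / δ⌉₊, fun n hn => ?_⟩
  have hnd : (d : ℝ) ≤ δ * n := by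
    rw [mul_comm, ← div_le_iff₀ hδ]
    exact (Nat.le_ceil _).trans (by exact_mod_cast (le_max_right _ _).trans hn)
  have hn0 : (0 : ℝ) < n := by
    by_contra! h
    nlinarith
  have hdn : d ≤ n := by
    have : (d : ℝ) ≤ n := by nlinarith
    exact_mod_cast this
  have hν := nu_nonneg hmono hm hd hdn
  have hνc : nu L n d hm hd ≤ L e₀ (1 / (8 * (m : ℝ) ^ 2)) / 4 := by
    refine nu_le hmono hzero hm hd hdn fun e =>
      (hmono e (div_mem_Icc hdn) ⟨by positivity, by linarith⟩ ?_).trans (hLu e)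
    rw [div_le_iff₀ hn0]
    linarith
  have hprob := expectation_le (n := n) (p := fun _ (_ : Fin m) => 1 / (m : ℝ)) (s := δ * n)
    (fun _ _ => by positivity) (fun _ => by simp [(by positivity : (m : ℝ) ≠ 0)])
    hη0.le (by linarith)
    (fun e => by
      rw [Finset.sum_const, card_univ, Fintype.card_fin, nsmul_eq_mul]
      nlinarith)
    (emptyProb_le_one hmono hzero hν hlam.le (by linarith) hm2 hd (n ^ K))
    (emptyProb_le hmono hzero hν hlam.le (by linarith) hm2 hd (by positivity) hη0.le (by linarith)
      (fun a ha => expected_load_ge hmono hzero hν hlam.le hlam1 hm2 hd hc he₀ hδ huw hLu hνc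
        (by linarith) ha) (n ^ K))
  have hweight : ∏ _i : Fin n, 1 / (m : ℝ) = 1 / (m : ℝ) ^ n := by simp
  rw [hweight] at hprob
  refine hprob.trans ?_
  have hpow : (2 : ℝ) ^ (-(η ^ 2 / 8 / Real.log 2 * n)) = Real.exp (-(η ^ 2 / 8 * n)) := by
    rw [Real.rpow_def_of_pos two_pos]
    have := (Real.log_pos one_lt_two).ne'
    congr 1
    field_simp
  rw [hpow]
  refine le_trans (le_of_eq ?_) (ENNReal.ofReal_le_ofReal (hN n ((le_max_left _ _).trans hn)))
  have hexp : -(2 * (η ^ 2 / 8) * (n : ℝ)) = -(η ^ 2 * n / 4) := by ring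
  rw [hexp, ENNReal.ofReal_mul (by positivity), ENNReal.ofReal_mul (by positivity),
    ENNReal.ofReal_add (by positivity) zero_le_one, ENNReal.ofReal_pow (by positivity),
    ENNReal.ofReal_natCast, ENNReal.ofReal_natCast, ENNReal.ofReal_one]
  push_cast
  ring

end Stmt9
end
end

section
/- In a singleton congestion game with linear latency functions ℓ_e(x) = a_e·x and no useless resources, let x be any state in which no player can decrease its latency by more than a_max by migrating to another link. Then n/A_Γ ≤ SC(x) ≤ 3·n/A_Γ, where n/A_Γ is the social cost of the optimal fractional assignment. -/
/-!
STATEMENT 10: In a singleton congestion game with linear latency functions `ℓ_e(x) = a_e·x`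
and no useless resources, any state in which no player can decrease its latency by more
than `a_max` by migrating to another link has social cost between `n/A_Γ` and `3·n/A_Γ`.
-/

open Finset

noncomputable section

namespace Stmt10

/-- Social cost `SC(x) = Σ_e (x_e/n)·ℓ_e(x_e)` of a state of a singleton congestion game
with linear latency functions `ℓ_e(x) = a_e·x`. -/
def SC {m : ℕ} (n : ℕ) (a : Fin m → ℝ) (x : Fin m → ℕ) : ℝ :=
  ∑ e, (x e : ℝ) / n * (a e * x e)

/-- Under the near-stability condition, every used link has latency at most `3·n/A_Γ`
(stated with the denominator cleared). -/
lemma latency_mul_le {m n : ℕ} {a : Fin m → ℝ} {amax : ℝ} {x : Fin m → ℕ}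
    (hpos : ∀ e, 0 < a e)
    (hamax : IsGreatest (Set.range a) amax)
    (hn : ∑ e, x e = n)
    (huseful : ∀ e, (∑ f, (a f)⁻¹) * a e ≤ (n : ℝ))
    (hstable : ∀ e f : Fin m, e ≠ f → 0 < x e →
      a e * x e - a f * (x f + 1) ≤ amax)
    {e : Fin m} (he : 0 < x e) :
    a e * x e * ∑ f, (a f)⁻¹ ≤ 3 * n := by
  obtain ⟨⟨g, rfl⟩, hmax⟩ := hamax
  have hle : ∀ f, a f ≤ a g := fun f => hmax ⟨f, rfl⟩
  have hterm : ∀ f, a e * x e * (a f)⁻¹ ≤ x f + 2 * (a g * (a f)⁻¹) := by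
    intro f
    have hlat : a e * x e ≤ a f * (x f + 1) + a g := by
      rcases eq_or_ne e f with rfl | hef
      · linarith [hpos e, hpos g]
      · linarith [hstable e f hef he]
    rw [← div_eq_mul_inv, ← div_eq_mul_inv, div_le_iff₀ (hpos f), add_mul, mul_assoc 2,
      div_mul_cancel₀ _ (hpos f).ne']
    linarith [hle f]
  have hload : (∑ f, (x f : ℝ)) = n := by exact_mod_cast hn
  calc a e * x e * ∑ f, (a f)⁻¹ = ∑ f, a e * x e * (a f)⁻¹ := mul_sum _ _ _
    _ ≤ ∑ f, (x f + 2 * (a g * (a f)⁻¹)) := sum_le_sum fun f _ => hterm f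
    _ = n + 2 * ((∑ f, (a f)⁻¹) * a g) := by
      rw [sum_add_distrib, hload, ← mul_sum, ← mul_sum, mul_comm (a g)]
    _ ≤ 3 * n := by linarith [huseful g]

/-- Let `x` be a state of a singleton congestion game with linear latency
functions `ℓ_e(x) = a_e·x` and no useless resources (`x̃_e = n/(A_Γ·a_e) ≥ 1` for all `e`)
in which no player can decrease its latency by more than `a_max` by migrating to another
link. Then `n/A_Γ ≤ SC(x) ≤ 3·n/A_Γ`, where `n/A_Γ` is the social cost of the optimal
fractional assignment. -/
theorem social_cost_of_near_stable_state
    (m n : ℕ) (a : Fin m → ℝ) (amax : ℝ) (x : Fin m → ℕ)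
    (hpos : ∀ e, 0 < a e)
    (hamax : IsGreatest (Set.range a) amax)
    (hn : ∑ e, x e = n)
    (huseful : ∀ e, (∑ f, (a f)⁻¹) * a e ≤ (n : ℝ))
    (hstable : ∀ e f : Fin m, e ≠ f → 0 < x e →
      a e * x e - a f * (x f + 1) ≤ amax) :
    (n : ℝ) / (∑ f, (a f)⁻¹) ≤ SC n a x ∧ SC n a x ≤ 3 * n / (∑ f, (a f)⁻¹) := by
  have hload : (∑ f, (x f : ℝ)) = n := by exact_mod_cast hn
  obtain ⟨g, -⟩ := hamax.1
  have hA : 0 < ∑ f, (a f)⁻¹ :=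
    sum_pos (fun f _ => inv_pos.2 (hpos f)) ⟨g, mem_univ g⟩
  have hn0 : (0 : ℝ) < n := (mul_pos hA (hpos g)).trans_le (huseful g)
  have hSC : SC n a x = (∑ e, a e * (x e : ℝ) ^ 2) / n := by
    rw [SC, sum_div]
    exact sum_congr rfl fun e _ => by ring
  rw [hSC]
  constructor
  · have hCS : (∑ f, (x f : ℝ)) ^ 2 ≤ (∑ f, a f * (x f : ℝ) ^ 2) * ∑ f, (a f)⁻¹ := by
      refine sum_sq_le_sum_mul_sum_of_sq_le_mul _
        (fun f _ => mul_nonneg (hpos f).le (sq_nonneg _))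
        (fun f _ => (inv_pos.2 (hpos f)).le) fun f _ => le_of_eq ?_
      have := (hpos f).ne'
      field_simp
    rw [hload] at hCS
    rw [div_le_div_iff₀ hA hn0]
    linarith
  · rw [div_le_div_iff₀ hn0 hA, sum_mul]
    calc ∑ e, a e * (x e : ℝ) ^ 2 * ∑ f, (a f)⁻¹ ≤ ∑ e, 3 * n * (x e : ℝ) := by
          refine sum_le_sum fun e _ => ?_
          rcases Nat.eq_zero_or_pos (x e) with he | he
          · simp [he]
          · have := mul_le_mul_of_nonneg_right
              (latency_mul_le hpos hamax hn huseful hstable he) (Nat.cast_nonneg (α := ℝ) (x e))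
            linarith
      _ = 3 * n * n := by rw [← mul_sum, hload]

end Stmt10
end
end

section
/- In a singleton congestion game with linear latency functions ℓ_e(x) = a_e·x in which the optimal fractional congestion satisfies x̃_e = n/(A_Γ·a_e) = Ω(log n) for every link e (with a large enough hidden constant), the Price of Imitation is at most 3 + o(1): for every δ > 0 there is n₀(δ), independent of the instance, such that for all n ≥ n₀(δ) the expected social cost I_Γ of the state to which the Imitation Protocol converges satisfies I_Γ ≤ (3+δ)·n/A_Γ. -/
/-!
STATEMENT 13: If the optimal fractional congestions satisfy `x̃_e = n/(A_Γ·a_e) = Ω(log n)`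
(with a large enough hidden constant), the Price of Imitation is at most `3 + o(1)`: for
every `δ > 0` and all large enough `n`, the expected social cost of the state to which the
Imitation Protocol converges is at most `(3+δ)·n/A_Γ`.
-/

open Finset
open scoped ENNReal

noncomputable section

namespace Stmt13

/-- Number of players on link `e` under the assignment `a` of the `n` players to the
`m` links of a singleton congestion game. -/
def counts {m : ℕ} (n : ℕ) (a : Fin n → Fin m) : Fin m → ℕ :=
  fun e => (univ.filter fun i => a i = e).card

/-- Migration probability of the Imitation Protocol in a singleton game with linear
latency functions `ℓ_e(x) = a_e·x` (elasticity bound `d = 1`, step size `ν = a_max`):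
if `a_e·x_e > a_f·(x_f+1) + a_max`, migrate with probability
`λ·(a_e·x_e − a_f·(x_f+1))/(a_e·x_e)`. -/
def migProb {m : ℕ} (c : Fin m → ℝ) (amax lam : ℝ) (x : Fin m → ℕ) (e f : Fin m) : ℝ :=
  if c f * (x f + 1) + amax < c e * x e then
    lam * ((c e * x e - c f * (x f + 1)) / (c e * x e))
  else 0

/-- Marginal distribution of the new link of player `i` in one round of the Imitation
Protocol: the player samples another player uniformly at random and, if the sampled link
promises a latency gain of more than `a_max`, migrates to it with probability `migProb`. -/
def marginal {m : ℕ} (c : Fin m → ℝ) (amax lam : ℝ) (n : ℕ) (a : Fin n → Fin m)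
    (i : Fin n) (f : Fin m) : ℝ :=
  if f = a i then
    1 - ∑ g : Fin m, (counts n a g : ℝ) / n * migProb c amax lam (counts n a) (a i) g
  else (counts n a f : ℝ) / n * migProb c amax lam (counts n a) (a i) f

/-- Probability that one round of the Imitation Protocol moves the assignment `a` to the
assignment `a'` (players update independently in parallel). -/
def roundProb {m : ℕ} (c : Fin m → ℝ) (amax lam : ℝ) (n : ℕ) (a a' : Fin n → Fin m) : ℝ :=
  ∏ i, marginal c amax lam n a i (a' i)

/-- A state is imitation-stable if no player can decrease its latency by more than
`a_max` by migrating to a nonempty link. -/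
def IsImitationStable {m : ℕ} (c : Fin m → ℝ) (amax : ℝ) (x : Fin m → ℕ) : Prop :=
  ∀ e f : Fin m, 0 < x e → 0 < x f → c e * x e ≤ c f * (x f + 1) + amax

/-- Social cost `SC(x) = Σ_e (x_e/n)·ℓ_e(x_e)`. -/
def SC {m : ℕ} (n : ℕ) (c : Fin m → ℝ) (x : Fin m → ℕ) : ℝ :=
  ∑ e, (x e : ℝ) / n * (c e * x e)

open scoped Classical in
/-- Expected social cost of the imitation dynamics stopped at an imitation-stable state:
`stoppedSC T a = E[SC(X_{min(τ,T)}) | X₀ = a]`, where `τ` is the absorption time into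
imitation-stable states.  Its limit as `T → ∞` is the expected social cost of the state to
which the dynamics converge. -/
noncomputable def stoppedSC {m : ℕ} (c : Fin m → ℝ) (amax lam : ℝ) (n : ℕ) :
    ℕ → (Fin n → Fin m) → ℝ≥0∞
  | 0, a => ENNReal.ofReal (SC n c (counts n a))
  | T + 1, a =>
      if IsImitationStable c amax (counts n a) then ENNReal.ofReal (SC n c (counts n a))
      else ∑ a' : Fin n → Fin m,
        ENNReal.ofReal (roundProb c amax lam n a a') * stoppedSC c amax lam n T a'

/-! ### Product distributions on assignments -/

lemma sum_prod_mul_prod {m n : ℕ} (p h : Fin n → Fin m → ℝ) :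
    ∑ a : Fin n → Fin m, (∏ i, p i (a i)) * ∏ i, h i (a i) = ∏ i, ∑ f, p i f * h i f := by
  simp only [Finset.prod_univ_sum, Fintype.piFinset_univ, Finset.prod_mul_distrib]

lemma sum_prod_eq_one {m n : ℕ} (p : Fin n → Fin m → ℝ) (hp : ∀ i, ∑ f, p i f = 1) :
    ∑ a : Fin n → Fin m, ∏ i, p i (a i) = 1 := by
  have h := sum_prod_mul_prod p (fun _ _ => 1)
  simpa [hp] using h

lemma pow_counts {m n : ℕ} (z : ℝ) (a : Fin n → Fin m) (e : Fin m) :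
    z ^ counts n a e = ∏ i, if a i = e then z else 1 := by
  simp [counts, Finset.prod_ite]

lemma counts_cast {m n : ℕ} (a : Fin n → Fin m) (e : Fin m) :
    (counts n a e : ℝ) = ∑ i, if a i = e then (1 : ℝ) else 0 := by
  simp [counts]

lemma sum_comp_assignment {m n : ℕ} (a : Fin n → Fin m) (h : Fin m → ℝ) :
    ∑ i, h (a i) = ∑ e, (counts n a e : ℝ) * h e := by
  simp only [counts_cast, Finset.sum_mul]
  rw [Finset.sum_comm]
  simp

lemma sum_counts {m n : ℕ} (a : Fin n → Fin m) : ∑ e, (counts n a e : ℝ) = n := by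
  have h := sum_comp_assignment a (fun _ => 1)
  simpa using h.symm

/-- Generating function of the load of link `e` under a product distribution. -/
lemma expect_pow_counts {m n : ℕ} (p : Fin n → Fin m → ℝ) (hp : ∀ i, ∑ f, p i f = 1)
    (z : ℝ) (e : Fin m) :
    ∑ a : Fin n → Fin m, (∏ i, p i (a i)) * z ^ counts n a e
      = ∏ i, (1 - p i e * (1 - z)) := by
  simp only [pow_counts]
  rw [sum_prod_mul_prod p (fun _ f => if f = e then z else 1)]
  refine Finset.prod_congr rfl fun i _ => ?_
  have h : ∀ f, p i f * (if f = e then z else 1)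
      = p i f - if f = e then p i f * (1 - z) else 0 := by
    intro f; split_ifs <;> ring
  simp [h, Finset.sum_sub_distrib, hp]

lemma expect_pair {m n : ℕ} (p : Fin n → Fin m → ℝ) (hp : ∀ i, ∑ f, p i f = 1)
    (e : Fin m) (i j : Fin n) :
    ∑ a : Fin n → Fin m, (∏ k, p k (a k)) *
        ((if a i = e then (1 : ℝ) else 0) * if a j = e then (1 : ℝ) else 0)
      = ∏ k ∈ ({i, j} : Finset (Fin n)), p k e := by
  have h : ∀ a : Fin n → Fin m,
      ((if a i = e then (1 : ℝ) else 0) * if a j = e then (1 : ℝ) else 0)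
        = ∏ k, if k ∈ ({i, j} : Finset (Fin n)) then (if a k = e then (1 : ℝ) else 0) else 1 := by
    intro a
    rw [Finset.prod_ite_mem, Finset.univ_inter]
    by_cases hij : i = j
    · subst hij; simp
    · rw [Finset.prod_pair hij]
  simp only [h]
  rw [sum_prod_mul_prod p
    (fun k f => if k ∈ ({i, j} : Finset (Fin n)) then (if f = e then (1 : ℝ) else 0) else 1)]
  rw [← Finset.univ_inter ({i, j} : Finset (Fin n)), ← Finset.prod_ite_mem]
  refine Finset.prod_congr rfl fun k _ => ?_
  rw [Finset.univ_inter]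
  split_ifs <;> simp [hp]

/-- Second moment of the load of link `e` under a product distribution. -/
lemma expect_sq_counts {m n : ℕ} (p : Fin n → Fin m → ℝ) (hp : ∀ i, ∑ f, p i f = 1)
    (e : Fin m) :
    ∑ a : Fin n → Fin m, (∏ i, p i (a i)) * (counts n a e : ℝ) ^ 2
      = (∑ i, p i e) ^ 2 + ∑ i, p i e * (1 - p i e) := by
  have h : ∀ a : Fin n → Fin m, (∏ i, p i (a i)) * (counts n a e : ℝ) ^ 2
      = ∑ i, ∑ j, (∏ k, p k (a k)) *
        ((if a i = e then (1 : ℝ) else 0) * if a j = e then (1 : ℝ) else 0) := by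
    intro a
    rw [counts_cast, sq, Finset.sum_mul_sum, Finset.mul_sum]
    simp only [Finset.mul_sum]
  simp only [h]
  rw [Finset.sum_comm]
  have h2 : ∀ i, ∑ a : Fin n → Fin m, ∑ j, (∏ k, p k (a k)) *
        ((if a i = e then (1 : ℝ) else 0) * if a j = e then (1 : ℝ) else 0)
      = p i e * ∑ j, p j e + p i e * (1 - p i e) := by
    intro i
    rw [Finset.sum_comm]
    simp only [expect_pair p hp]
    have h3 : ∀ j, ∏ k ∈ ({i, j} : Finset (Fin n)), p k e
        = p i e * p j e + if j = i then p i e * (1 - p i e) else 0 := by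
      intro j
      by_cases hij : j = i
      · subst hij; simp; ring
      · rw [Finset.prod_pair (Ne.symm hij)]; simp [hij]
    simp [h3, Finset.sum_add_distrib, Finset.mul_sum]
  simp only [h2, Finset.sum_add_distrib, ← Finset.sum_mul]
  ring

/-! ### Deterministic estimates on expected flows -/

/-- Drift of the quadratic potential `∑ c_e y_e²` when `F e f` is the expected flow from `e`
to `f` and `γ e f` the latency gain of that move. -/
lemma potential_drift {ι : Type*} [Fintype ι] (c y : ι → ℝ) (γ F : ι → ι → ℝ)
    (amax lam n : ℝ) (hc : ∀ e, 0 < c e) (hca : ∀ e, c e ≤ amax) (hy : ∀ e, 0 ≤ y e)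
    (hn : 0 < n) (hsum : ∑ e, y e = n) (hγ : ∀ e f, 0 ≤ γ e f)
    (hγg : ∀ e f, γ e f * (c e * y e - c f * y f - c f) = γ e f ^ 2)
    (hγa : ∀ e f, γ e f * amax ≤ γ e f ^ 2) (hl : 0 ≤ lam) (hl' : lam ≤ 1 / 4)
    (hF : ∀ e f, F e f = lam * y f * γ e f / (n * c e)) :
    ∑ e, c e * ((y e + ∑ g, F g e - ∑ g, F e g) ^ 2 + ∑ g, F g e + ∑ g, F e g)
      ≤ ∑ e, c e * y e ^ 2 - 1 / 2 * ∑ e, ∑ f, F e f * γ e f := by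
  have hF0 : ∀ e f, 0 ≤ F e f := by
    intro e f
    rw [hF]
    have := hc e; have := hy f; have := hγ e f
    positivity
  have hOut : ∀ e, c e * (∑ g, F e g) ^ 2 ≤ lam * ∑ g, F e g * γ e g := by
    intro e
    have h1 : (∑ g, y g * γ e g) ^ 2 ≤ n * ∑ g, y g * γ e g ^ 2 := by
      rw [← hsum]
      refine Finset.sum_sq_le_sum_mul_sum_of_sq_le_mul _ (fun g _ => hy g)
        (fun g _ => mul_nonneg (hy g) (sq_nonneg _)) (fun g _ => le_of_eq (by ring))
    have h2 : ∑ g, F e g = lam / (n * c e) * ∑ g, y g * γ e g := by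
      rw [Finset.mul_sum]
      refine Finset.sum_congr rfl fun g _ => ?_
      rw [hF]; ring
    have h3 : ∑ g, F e g * γ e g = lam / (n * c e) * ∑ g, y g * γ e g ^ 2 := by
      rw [Finset.mul_sum]
      refine Finset.sum_congr rfl fun g _ => ?_
      rw [hF]; ring
    rw [h2, h3]
    have hce := hc e
    calc c e * (lam / (n * c e) * ∑ g, y g * γ e g) ^ 2
        = lam ^ 2 / (n ^ 2 * c e) * (∑ g, y g * γ e g) ^ 2 := by field_simp
      _ ≤ lam ^ 2 / (n ^ 2 * c e) * (n * ∑ g, y g * γ e g ^ 2) := by gcongr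
      _ = _ := by field_simp
  have hIn : ∀ f, c f * (∑ e, F e f) ^ 2 ≤ lam * ∑ e, F e f * γ e f := by
    intro f
    set S : Finset ι := Finset.univ.filter (fun e => γ e f ≠ 0) with hS
    have h1 : (∑ e ∈ S, γ e f / c e) ^ 2 ≤ (∑ e ∈ S, (c e)⁻¹) * ∑ e ∈ S, γ e f ^ 2 / c e := by
      refine Finset.sum_sq_le_sum_mul_sum_of_sq_le_mul _ (fun e _ => (inv_pos.2 (hc e)).le)
        (fun e _ => div_nonneg (sq_nonneg _) (hc e).le) (fun e _ => le_of_eq (by ring))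
    have h4 : c f * y f * ∑ e ∈ S, (c e)⁻¹ ≤ n := by
      rw [Finset.mul_sum, ← hsum]
      refine le_trans (Finset.sum_le_sum fun e he => ?_)
        (Finset.sum_le_sum_of_subset_of_nonneg (Finset.subset_univ S) fun e _ _ => hy e)
      have hne : γ e f ≠ 0 := (Finset.mem_filter.1 he).2
      have hpos : 0 < γ e f := lt_of_le_of_ne (hγ e f) (Ne.symm hne)
      have h5 : c e * y e - c f * y f - c f = γ e f := by
        have := hγg e f
        rw [sq] at this
        exact mul_left_cancel₀ hne this
      rw [← div_eq_mul_inv, div_le_iff₀ (hc e)]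
      have := hc f
      nlinarith
    have h2 : ∑ e, F e f = lam * y f / n * ∑ e ∈ S, γ e f / c e := by
      rw [Finset.mul_sum, hS, Finset.sum_filter]
      refine Finset.sum_congr rfl fun e _ => ?_
      rw [hF]
      have := (hc e).ne'
      split_ifs with h
      · field_simp
      · have : γ e f = 0 := by simpa using h
        simp [this]
    have h3 : ∑ e, F e f * γ e f = lam * y f / n * ∑ e ∈ S, γ e f ^ 2 / c e := by
      rw [Finset.mul_sum, hS, Finset.sum_filter]
      refine Finset.sum_congr rfl fun e _ => ?_
      rw [hF]
      have := (hc e).ne'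
      split_ifs with h
      · field_simp
      · have : γ e f = 0 := by simpa using h
        simp [this]
    rw [h2, h3]
    have hyf := hy f
    have hcf := hc f
    have hQ : 0 ≤ ∑ e ∈ S, γ e f ^ 2 / c e :=
      Finset.sum_nonneg fun e _ => div_nonneg (sq_nonneg _) (hc e).le
    calc c f * (lam * y f / n * ∑ e ∈ S, γ e f / c e) ^ 2
        = lam ^ 2 * y f / n ^ 2 * (c f * y f) * (∑ e ∈ S, γ e f / c e) ^ 2 := by ring
      _ ≤ lam ^ 2 * y f / n ^ 2 * (c f * y f) *
            ((∑ e ∈ S, (c e)⁻¹) * ∑ e ∈ S, γ e f ^ 2 / c e) := by gcongr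
      _ = lam ^ 2 * y f / n ^ 2 * (∑ e ∈ S, γ e f ^ 2 / c e) *
            (c f * y f * ∑ e ∈ S, (c e)⁻¹) := by ring
      _ ≤ lam ^ 2 * y f / n ^ 2 * (∑ e ∈ S, γ e f ^ 2 / c e) * n := by gcongr
      _ = _ := by field_simp
  have hterm : ∀ e f, F e f * (2 * (c f * y f - c e * y e) + c e + c f) ≤ - (F e f * γ e f) := by
    intro e f
    have hk : 0 ≤ lam * y f / (n * c e) := by
      have := hc e; have := hy f
      positivity
    have h1 : γ e f * (2 * (c f * y f - c e * y e) + c e + c f) ≤ -(γ e f * γ e f) := by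
      have h2 := hγg e f
      have h3 := hγa e f
      have h4 := mul_le_mul_of_nonneg_left (hca e) (hγ e f)
      have h5 := mul_nonneg (hγ e f) (hc f).le
      nlinarith
    have h6 : F e f = lam * y f / (n * c e) * γ e f := by rw [hF]; ring
    rw [h6]
    have := mul_le_mul_of_nonneg_left h1 hk
    nlinarith
  have hlin : ∑ e, c e * (2 * y e * (∑ g, F g e - ∑ g, F e g) + ∑ g, F g e + ∑ g, F e g)
      = ∑ e, ∑ f, F e f * (2 * (c f * y f - c e * y e) + c e + c f) := by
    have h1 : ∀ e, c e * (2 * y e * (∑ g, F g e - ∑ g, F e g) + ∑ g, F g e + ∑ g, F e g)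
        = ∑ g, F g e * (2 * (c e * y e) + c e) + ∑ g, F e g * (c e - 2 * (c e * y e)) := by
      intro e
      rw [← Finset.sum_mul, ← Finset.sum_mul]; ring
    simp only [h1, Finset.sum_add_distrib]
    rw [Finset.sum_comm, ← Finset.sum_add_distrib]
    refine Finset.sum_congr rfl fun e _ => ?_
    rw [← Finset.sum_add_distrib]
    refine Finset.sum_congr rfl fun f _ => ?_
    ring
  have hsq : ∀ e, c e * ((y e + ∑ g, F g e - ∑ g, F e g) ^ 2 + ∑ g, F g e + ∑ g, F e g)
      ≤ c e * y e ^ 2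
        + c e * (2 * y e * (∑ g, F g e - ∑ g, F e g) + ∑ g, F g e + ∑ g, F e g)
        + (lam * ∑ g, F g e * γ g e + lam * ∑ g, F e g * γ e g) := by
    intro e
    have h1 := hIn e
    have h2 := hOut e
    have h3 : 0 ≤ ∑ g, F g e := Finset.sum_nonneg fun g _ => hF0 g e
    have h4 : 0 ≤ ∑ g, F e g := Finset.sum_nonneg fun g _ => hF0 e g
    have h5 := mul_nonneg (hc e).le (mul_nonneg h3 h4)
    nlinarith
  have htot := Finset.sum_le_sum fun e (_ : e ∈ (Finset.univ : Finset ι)) => hsq e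
  have hle : ∑ e, ∑ f, F e f * (2 * (c f * y f - c e * y e) + c e + c f)
      ≤ ∑ e, ∑ f, -(F e f * γ e f) :=
    Finset.sum_le_sum fun e _ => Finset.sum_le_sum fun f _ => hterm e f
  simp only [Finset.sum_add_distrib, ← Finset.mul_sum, Finset.sum_neg_distrib] at htot hle
  rw [Finset.sum_comm (f := fun e g => F g e * γ g e)] at htot
  have hP : 0 ≤ ∑ e, ∑ f, F e f * γ e f :=
    Finset.sum_nonneg fun e _ => Finset.sum_nonneg fun f _ => mul_nonneg (hF0 e f) (hγ e f)
  nlinarith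

/-! ### One round of the Imitation Protocol -/

/-- Latency gain of a move from `e` to `f`, set to `0` when the move is not admissible. -/
def admGain {m : ℕ} (c : Fin m → ℝ) (amax : ℝ) (x : Fin m → ℕ) (e f : Fin m) : ℝ :=
  if c f * (x f + 1) + amax < c e * x e then c e * x e - c f * (x f + 1) else 0

/-- Expected number of players migrating from `e` to `f` in one round. -/
def flow {m : ℕ} (c : Fin m → ℝ) (amax lam : ℝ) (n : ℕ) (x : Fin m → ℕ) (e f : Fin m) : ℝ :=
  x e * (x f / n * migProb c amax lam x e f)

/-- The quadratic potential `∑ c_e x_e²`. -/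
def quadPot {m : ℕ} (c : Fin m → ℝ) (x : Fin m → ℕ) : ℝ := ∑ e, c e * (x e : ℝ) ^ 2

section Round

variable {m n : ℕ} {c : Fin m → ℝ} {amax lam : ℝ}

lemma migProb_self (hc : ∀ e, 0 < c e) (ha : 0 < amax) (x : Fin m → ℕ) (e : Fin m) :
    migProb c amax lam x e e = 0 := by
  rw [migProb, if_neg]
  have := hc e
  nlinarith

lemma migProb_nonneg (hc : ∀ e, 0 < c e) (ha : 0 < amax) (hl : 0 ≤ lam) (x : Fin m → ℕ)
    (e f : Fin m) : 0 ≤ migProb c amax lam x e f := by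
  rw [migProb]
  split_ifs with h
  · have h1 := hc e
    exact mul_nonneg hl (div_nonneg (by linarith) (by positivity))
  · exact le_rfl

lemma migProb_le (hc : ∀ e, 0 < c e) (hl : 0 ≤ lam) (x : Fin m → ℕ)
    (e f : Fin m) : migProb c amax lam x e f ≤ lam := by
  rw [migProb]
  split_ifs with h
  · have h1 := hc e
    have h2 := hc f
    refine mul_le_of_le_one_right hl (div_le_one_of_le₀ ?_ (by positivity))
    have : 0 ≤ c f * (x f + 1 : ℝ) := by positivity
    linarith
  · exact hl

lemma admGain_nonneg (ha : 0 < amax) (x : Fin m → ℕ) (e f : Fin m) :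
    0 ≤ admGain c amax x e f := by
  rw [admGain]
  split_ifs <;> linarith

lemma mul_migProb (hc : ∀ e, 0 < c e) (ha : 0 < amax) (x : Fin m → ℕ) (e f : Fin m) :
    x e * migProb c amax lam x e f = lam * admGain c amax x e f / c e := by
  rw [migProb, admGain]
  split_ifs with h
  · have h1 := hc e
    have h2 : 0 ≤ c f * (x f + 1 : ℝ) := by have := hc f; positivity
    have h3 : (x e : ℝ) ≠ 0 := by
      rintro h0
      rw [h0] at h
      linarith
    field_simp
  · simp

lemma flow_eq (hc : ∀ e, 0 < c e) (ha : 0 < amax) (x : Fin m → ℕ) (e f : Fin m) :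
    flow c amax lam n x e f = lam * x f * admGain c amax x e f / (n * c e) := by
  have h := mul_migProb (lam := lam) hc ha x e f
  calc flow c amax lam n x e f = x f / n * (x e * migProb c amax lam x e f) := by
        rw [flow]; ring
    _ = _ := by rw [h, div_mul_div_comm]; ring

lemma flow_nonneg (hc : ∀ e, 0 < c e) (ha : 0 < amax) (hl : 0 ≤ lam) (x : Fin m → ℕ)
    (e f : Fin m) : 0 ≤ flow c amax lam n x e f := by
  have := migProb_nonneg (lam := lam) hc ha hl x e f
  rw [flow]
  positivity

lemma sum_rate_le (hc : ∀ e, 0 < c e) (hl : 0 ≤ lam) (hn : 0 < n) (a : Fin n → Fin m)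
    (e : Fin m) :
    ∑ g, (counts n a g : ℝ) / n * migProb c amax lam (counts n a) e g ≤ lam := by
  have hn' : (0 : ℝ) < n := by exact_mod_cast hn
  calc ∑ g, (counts n a g : ℝ) / n * migProb c amax lam (counts n a) e g
      ≤ ∑ g, (counts n a g : ℝ) / n * lam :=
        Finset.sum_le_sum fun g _ =>
          mul_le_mul_of_nonneg_left (migProb_le hc hl _ e g) (by positivity)
    _ = lam := by
        rw [← Finset.sum_mul, ← Finset.sum_div, sum_counts, div_self hn'.ne', one_mul]

lemma sum_flow_out (x : Fin m → ℕ) (e : Fin m) :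
    ∑ g, flow c amax lam n x e g
      = x e * ∑ g, (x g : ℝ) / n * migProb c amax lam x e g := by
  simp only [flow, Finset.mul_sum]

lemma marginal_eq (hc : ∀ e, 0 < c e) (ha : 0 < amax) (a : Fin n → Fin m) (i : Fin n)
    (f : Fin m) :
    marginal c amax lam n a i f
      = (if a i = f then
          1 - ∑ g, (counts n a g : ℝ) / n * migProb c amax lam (counts n a) f g else 0)
        + (counts n a f : ℝ) / n * migProb c amax lam (counts n a) (a i) f := by
  rw [marginal]
  by_cases h : f = a i
  · subst h
    simp [migProb_self hc ha]
  · simp [h, Ne.symm h]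

lemma marginal_nonneg (hc : ∀ e, 0 < c e) (ha : 0 < amax) (hl : 0 ≤ lam) (hl1 : lam ≤ 1)
    (hn : 0 < n) (a : Fin n → Fin m) (i : Fin n) (f : Fin m) :
    0 ≤ marginal c amax lam n a i f := by
  have h := migProb_nonneg (lam := lam) hc ha hl (counts n a) (a i) f
  rw [marginal]
  split_ifs
  · have := sum_rate_le (amax := amax) hc hl hn a (a i)
    linarith
  · positivity

lemma sum_marginal (hc : ∀ e, 0 < c e) (ha : 0 < amax) (a : Fin n → Fin m) (i : Fin n) :
    ∑ f, marginal c amax lam n a i f = 1 := by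
  simp [marginal_eq hc ha, Finset.sum_add_distrib]

lemma sum_marginal_players (hc : ∀ e, 0 < c e) (ha : 0 < amax) (a : Fin n → Fin m)
    (e : Fin m) :
    ∑ i, marginal c amax lam n a i e
      = counts n a e + ∑ g, flow c amax lam n (counts n a) g e
        - ∑ g, flow c amax lam n (counts n a) e g := by
  simp only [marginal_eq hc ha, Finset.sum_add_distrib]
  rw [sum_comp_assignment a
    (fun g => (counts n a e : ℝ) / n * migProb c amax lam (counts n a) g e), sum_flow_out,
    sum_comp_assignment a (fun g => if g = e then
      1 - ∑ f, (counts n a f : ℝ) / n * migProb c amax lam (counts n a) e f else 0)]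
  simp only [flow, mul_ite, mul_zero, Finset.sum_ite_eq', Finset.mem_univ, if_true]
  ring

lemma sum_marginal_var_le (hc : ∀ e, 0 < c e) (ha : 0 < amax) (hl : 0 ≤ lam) (hl1 : lam ≤ 1)
    (hn : 0 < n) (a : Fin n → Fin m) (e : Fin m) :
    ∑ i, marginal c amax lam n a i e * (1 - marginal c amax lam n a i e)
      ≤ ∑ g, flow c amax lam n (counts n a) g e + ∑ g, flow c amax lam n (counts n a) e g := by
  set R := ∑ g, (counts n a g : ℝ) / n * migProb c amax lam (counts n a) e g with hR
  have h : ∀ i, marginal c amax lam n a i e * (1 - marginal c amax lam n a i e)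
      ≤ (counts n a e : ℝ) / n * migProb c amax lam (counts n a) (a i) e
        + if a i = e then R else 0 := by
    intro i
    have h0 := marginal_nonneg hc ha hl hl1 hn a i e
    have h1 := marginal_eq (lam := lam) hc ha a i e
    rw [← hR] at h1
    by_cases hi : a i = e
    · rw [hi, migProb_self hc ha] at h1 ⊢
      simp only [if_true, mul_zero, add_zero, zero_add] at h1 ⊢
      rw [h1]
      nlinarith [sq_nonneg R]
    · simp only [hi, if_false, zero_add, add_zero] at h1 ⊢
      nlinarith
  refine (Finset.sum_le_sum fun i _ => h i).trans (le_of_eq ?_)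
  rw [Finset.sum_add_distrib, sum_comp_assignment a
    (fun g => (counts n a e : ℝ) / n * migProb c amax lam (counts n a) g e), sum_flow_out,
    sum_comp_assignment a (fun g => if g = e then R else 0)]
  simp only [flow, mul_ite, mul_zero, Finset.sum_ite_eq', Finset.mem_univ, if_true]
  rw [hR]

lemma roundProb_nonneg (hc : ∀ e, 0 < c e) (ha : 0 < amax) (hl : 0 ≤ lam) (hl1 : lam ≤ 1)
    (hn : 0 < n) (a a' : Fin n → Fin m) : 0 ≤ roundProb c amax lam n a a' :=
  Finset.prod_nonneg fun i _ => marginal_nonneg hc ha hl hl1 hn a i (a' i)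

lemma sum_roundProb (hc : ∀ e, 0 < c e) (ha : 0 < amax) (a : Fin n → Fin m) :
    ∑ a', roundProb c amax lam n a a' = 1 :=
  sum_prod_eq_one _ (sum_marginal hc ha a)

/-- In a state that is not imitation-stable the expected potential drops by a fixed amount. -/
lemma expect_quadPot_le (hc : ∀ e, 0 < c e) (hca : ∀ e, c e ≤ amax) (ha : 0 < amax)
    (hl : 0 ≤ lam) (hl1 : lam ≤ 1 / 4) (hn : 0 < n) (a : Fin n → Fin m)
    (hst : ¬ IsImitationStable c amax (counts n a)) :
    ∑ a', roundProb c amax lam n a a' * quadPot c (counts n a')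
      ≤ quadPot c (counts n a) - lam * amax / (2 * n) := by
  have hn' : (0 : ℝ) < n := by exact_mod_cast hn
  set x := counts n a with hx
  have hdrift := potential_drift c (fun e => (x e : ℝ)) (admGain c amax x)
    (flow c amax lam n x) amax lam n hc hca (fun e => Nat.cast_nonneg _) hn' (sum_counts a)
    (admGain_nonneg ha x)
    (by
      intro e f
      rw [admGain]
      split_ifs <;> ring)
    (by
      intro e f
      rw [admGain]
      split_ifs <;> nlinarith)
    hl hl1 (flow_eq hc ha x)
  have hexp : ∑ a', roundProb c amax lam n a a' * quadPot c (counts n a')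
      ≤ ∑ e, c e * (((x e : ℝ) + ∑ g, flow c amax lam n x g e - ∑ g, flow c amax lam n x e g) ^ 2
          + ∑ g, flow c amax lam n x g e + ∑ g, flow c amax lam n x e g) := by
    simp only [quadPot, Finset.mul_sum]
    rw [Finset.sum_comm]
    refine Finset.sum_le_sum fun e _ => ?_
    have h1 := expect_sq_counts (fun i f => marginal c amax lam n a i f) (sum_marginal hc ha a) e
    have h2 := sum_marginal_var_le hc ha hl (by linarith) hn a e
    rw [sum_marginal_players hc ha] at h1
    calc ∑ a', roundProb c amax lam n a a' * (c e * (counts n a' e : ℝ) ^ 2)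
        = c e * ∑ a', roundProb c amax lam n a a' * (counts n a' e : ℝ) ^ 2 := by
          rw [Finset.mul_sum]
          exact Finset.sum_congr rfl fun _ _ => by ring
      _ ≤ _ := by
          refine mul_le_mul_of_nonneg_left ?_ (hc e).le
          simp only [roundProb]
          rw [h1]
          linarith
  have hgap : lam * amax / n ≤ ∑ e, ∑ f, flow c amax lam n x e f * admGain c amax x e f := by
    simp only [IsImitationStable] at hst
    push Not at hst
    obtain ⟨e, f, -, hf, hef⟩ := hst
    have h0 : ∀ e f, 0 ≤ flow c amax lam n x e f * admGain c amax x e f := fun e f =>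
      mul_nonneg (flow_nonneg hc ha hl x e f) (admGain_nonneg ha x e f)
    have h1 : flow c amax lam n x e f * admGain c amax x e f
        ≤ ∑ e, ∑ f, flow c amax lam n x e f * admGain c amax x e f :=
      (Finset.single_le_sum (f := fun f => flow c amax lam n x e f * admGain c amax x e f)
        (fun f _ => h0 e f) (Finset.mem_univ f)).trans
      (Finset.single_le_sum (f := fun e => ∑ f, flow c amax lam n x e f * admGain c amax x e f)
        (fun e _ => Finset.sum_nonneg fun f _ => h0 e f) (Finset.mem_univ e))
    refine le_trans ?_ h1
    have hg : amax ≤ admGain c amax x e f := by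
      rw [admGain, if_pos hef]; linarith
    have hxf : (1 : ℝ) ≤ x f := by exact_mod_cast hf
    have hce := hc e
    rw [flow_eq hc ha]
    rw [div_mul_eq_mul_div, div_le_div_iff₀ hn' (by positivity)]
    have hcea := hca e
    have h2 : amax * c e ≤ x f * (admGain c amax x e f * admGain c amax x e f) := by
      have h3 : amax * c e ≤ admGain c amax x e f * admGain c amax x e f :=
        mul_le_mul hg (hcea.trans hg) hce.le (ha.le.trans hg)
      nlinarith [mul_self_nonneg (admGain c amax x e f)]
    have h4 := mul_le_mul_of_nonneg_left h2 (mul_nonneg hl hn'.le)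
    nlinarith
  have hhalf : lam * amax / (2 * n) = 1 / 2 * (lam * amax / n) := by field_simp
  rw [hhalf]
  have : quadPot c x = ∑ e, c e * (x e : ℝ) ^ 2 := rfl
  linarith

/-- Underloaded links gain players in expectation. -/
lemma net_flow_ge (hc : ∀ e, 0 < c e) (hca : ∀ e, c e ≤ amax) (ha : 0 < amax)
    (hl : 0 ≤ lam) (hn : 0 < n) (a : Fin n → Fin m) (e : Fin m) :
    lam * counts n a e * (1 - (c e * counts n a e + 2 * amax) * (∑ f, (c f)⁻¹) / n)
      ≤ ∑ g, flow c amax lam n (counts n a) g e - ∑ g, flow c amax lam n (counts n a) e g := by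
  have hn' : (0 : ℝ) < n := by exact_mod_cast hn
  set x := counts n a with hx
  have hterm : ∀ g, lam * (x g - (c e * x e + 2 * amax) * (c g)⁻¹)
      ≤ x g * migProb c amax lam x g e - x g * migProb c amax lam x e g := by
    intro g
    have hcg := hc g
    have hce := hc e
    have hL : ∀ y : ℝ, y - (c e * x e + 2 * amax) * (c g)⁻¹
        = (c g * y - c e * x e - 2 * amax) / c g := by
      intro y; field_simp; ring
    by_cases h1 : c e * (x e + 1) + amax < c g * x g
    · have h2 : migProb c amax lam x e g = 0 := by
        rw [migProb, if_neg]
        nlinarith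
      rw [h2, mul_migProb hc ha, admGain, if_pos h1, hL, mul_zero, sub_zero, mul_div_assoc]
      refine mul_le_mul_of_nonneg_left (div_le_div_of_nonneg_right ?_ hcg.le) hl
      have := hca e
      linarith
    · have h2 : migProb c amax lam x g e = 0 := by rw [migProb, if_neg h1]
      rw [h2]
      by_cases h3 : c g * (x g + 1) + amax < c e * x e
      · rw [migProb, if_pos h3, hL]
        have hxg : (0 : ℝ) ≤ x g := Nat.cast_nonneg _
        have hLg : 0 ≤ c g * (x g : ℝ) := by positivity
        have hLe : 0 < c e * (x e : ℝ) := by nlinarith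
        have h5 : x g * ((c e * x e - c g * (x g + 1)) / (c e * x e))
            ≤ -((c g * x g - c e * x e - 2 * amax) / c g) := by
          rw [← neg_div, ← mul_div_assoc, div_le_div_iff₀ hLe hcg]
          have h6 : c g * x g * (c e * x e - c g * (x g + 1))
              ≤ c e * x e * (c e * x e - c g * (x g + 1)) :=
            mul_le_mul_of_nonneg_right (by nlinarith) (by nlinarith)
          nlinarith
        have := mul_le_mul_of_nonneg_left h5 hl
        nlinarith
      · have h4 : migProb c amax lam x e g = 0 := by rw [migProb, if_neg h3]
        rw [h4, hL, mul_zero, sub_zero]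
        refine mul_nonpos_of_nonneg_of_nonpos hl (div_nonpos_of_nonpos_of_nonneg ?_ hcg.le)
        have := hca e
        nlinarith
  have hsum := Finset.sum_le_sum fun g (_ : g ∈ (Finset.univ : Finset (Fin m))) => hterm g
  rw [← Finset.mul_sum, Finset.sum_sub_distrib, sum_counts, ← Finset.mul_sum] at hsum
  have h1 : ∑ g, flow c amax lam n x g e - ∑ g, flow c amax lam n x e g
      = x e / n * ∑ g, (x g * migProb c amax lam x g e - x g * migProb c amax lam x e g) := by
    rw [← Finset.sum_sub_distrib, Finset.mul_sum]
    refine Finset.sum_congr rfl fun g _ => ?_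
    rw [flow, flow]; ring
  rw [h1]
  have h2 := mul_le_mul_of_nonneg_left hsum (div_nonneg (Nat.cast_nonneg (x e)) hn'.le)
  refine le_trans (le_of_eq ?_) h2
  field_simp

lemma expect_pow_counts_le (hc : ∀ e, 0 < c e) (ha : 0 < amax) (hl : 0 ≤ lam)
    (a : Fin n → Fin m) (e : Fin m) (hl1 : lam ≤ 1) (hn : 0 < n) :
    ∑ a', roundProb c amax lam n a a' * (4 / 5 : ℝ) ^ counts n a' e
      ≤ (4 / 5 : ℝ) ^ counts n a e *
        Real.exp ((∑ g, flow c amax lam n (counts n a) e g) / 4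
          - (∑ g, flow c amax lam n (counts n a) g e) / 5) := by
  set R := ∑ g, (counts n a g : ℝ) / n * migProb c amax lam (counts n a) e g with hR
  have h1 := expect_pow_counts (fun i f => marginal c amax lam n a i f)
    (sum_marginal hc ha a) (4 / 5) e
  simp only [roundProb]
  rw [h1]
  have hle : ∀ i, 1 - marginal c amax lam n a i e * (1 - 4 / 5)
      ≤ (if a i = e then (4 / 5 : ℝ) else 1) * Real.exp ((if a i = e then R / 4 else 0)
        - (counts n a e : ℝ) / n * migProb c amax lam (counts n a) (a i) e / 5) := by
    intro i
    rw [marginal_eq hc ha, ← hR]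
    by_cases hi : a i = e
    · rw [hi, migProb_self hc ha]
      simp only [if_true, mul_zero, add_zero, zero_div, sub_zero]
      have := Real.add_one_le_exp (R / 4)
      linarith
    · simp only [hi, if_false, zero_add, one_mul, zero_sub]
      have := Real.add_one_le_exp
        (-((counts n a e : ℝ) / n * migProb c amax lam (counts n a) (a i) e / 5))
      linarith
  have h0 : ∀ i, 0 ≤ 1 - marginal c amax lam n a i e * (1 - 4 / 5) := by
    intro i
    have h2 := Finset.single_le_sum (f := fun f => marginal c amax lam n a i f)
      (fun f _ => marginal_nonneg hc ha hl hl1 hn a i f) (Finset.mem_univ e)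
    rw [sum_marginal hc ha] at h2
    linarith
  refine (Finset.prod_le_prod (fun i _ => h0 i) fun i _ => hle i).trans (le_of_eq ?_)
  rw [Finset.prod_mul_distrib, ← pow_counts, ← Real.exp_sum, Finset.sum_sub_distrib,
    ← Finset.sum_div, sum_comp_assignment a
      (fun g => (counts n a e : ℝ) / n * migProb c amax lam (counts n a) g e), sum_flow_out,
    sum_comp_assignment a (fun g => if g = e then R / 4 else 0)]
  simp only [flow, mul_ite, mul_zero, Finset.sum_ite_eq', Finset.mem_univ, if_true]
  rw [← hR, mul_div_assoc]

lemma pow_mul_exp_le (k : ℕ) (hl : 0 ≤ lam) (hl1 : lam ≤ 1 / 4) :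
    (4 / 5 : ℝ) ^ k * Real.exp (lam * k / 4)
      ≤ (4 / 5 : ℝ) ^ k + lam * (4 * Real.exp (-(k : ℝ) / 16)) := by
  have hk : (0 : ℝ) ≤ k := Nat.cast_nonneg k
  set y := lam * k / 4 with hy
  have hy0 : 0 ≤ y := by positivity
  have h1 : Real.exp y ≤ 1 + y * Real.exp y := by
    have h := Real.add_one_le_exp (-y)
    have h2 := mul_le_mul_of_nonneg_right h (Real.exp_pos y).le
    rw [← Real.exp_add, neg_add_cancel, Real.exp_zero] at h2
    linarith
  have hz : (4 / 5 : ℝ) ^ k ≤ Real.exp (-(k : ℝ) / 5) := by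
    have h := Real.add_one_le_exp (-(1 / 5 : ℝ))
    calc (4 / 5 : ℝ) ^ k ≤ Real.exp (-(1 / 5 : ℝ)) ^ k := by
          gcongr; linarith
      _ = Real.exp (-(k : ℝ) / 5) := by rw [← Real.exp_nat_mul]; congr 1; ring
  have hyk : Real.exp y ≤ Real.exp ((k : ℝ) / 16) := Real.exp_le_exp.2 (by rw [hy]; nlinarith)
  have hk16 : (k : ℝ) / 16 ≤ Real.exp ((k : ℝ) / 16) := by
    have := Real.add_one_le_exp ((k : ℝ) / 16); linarith
  have hmain : (4 / 5 : ℝ) ^ k * (y * Real.exp y) ≤ lam * (4 * Real.exp (-(k : ℝ) / 16)) := by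
    calc (4 / 5 : ℝ) ^ k * (y * Real.exp y)
        ≤ Real.exp (-(k : ℝ) / 5) * (y * Real.exp ((k : ℝ) / 16)) := by gcongr
      _ = lam * 4 * (Real.exp (-(k : ℝ) / 5) * (k / 16 * Real.exp ((k : ℝ) / 16))) := by
          rw [hy]; ring
      _ ≤ lam * 4 * (Real.exp (-(k : ℝ) / 5) *
            (Real.exp ((k : ℝ) / 16) * Real.exp ((k : ℝ) / 16))) := by gcongr
      _ = lam * 4 * Real.exp (-(k : ℝ) / 5 + (k / 16 + k / 16)) := by
          rw [Real.exp_add, Real.exp_add]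
      _ ≤ lam * 4 * Real.exp (-(k : ℝ) / 16) := by
          gcongr; linarith
      _ = _ := by ring
  have := mul_le_mul_of_nonneg_left h1 (by positivity : (0 : ℝ) ≤ (4 / 5 : ℝ) ^ k)
  nlinarith

/-- The exponential weight detecting an empty link is almost a supermartingale. -/
lemma expect_weight_le (hc : ∀ e, 0 < c e) (hca : ∀ e, c e ≤ amax) (ha : 0 < amax)
    (hl : 0 ≤ lam) (hl1 : lam ≤ 1 / 4) (hn : 0 < n)
    (hA : 8 * (amax * ∑ f, (c f)⁻¹) ≤ n) (a : Fin n → Fin m) (e : Fin m) :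
    ∑ a', roundProb c amax lam n a a' * (4 / 5 : ℝ) ^ counts n a' e
      ≤ (4 / 5 : ℝ) ^ counts n a e
        + lam * (4 * Real.exp (-((n : ℝ) / ((∑ f, (c f)⁻¹) * c e)) / 32)) := by
  have hn' : (0 : ℝ) < n := by exact_mod_cast hn
  have hce := hc e
  have hApos : 0 < ∑ f, (c f)⁻¹ :=
    Finset.sum_pos (fun f _ => inv_pos.2 (hc f)) ⟨e, Finset.mem_univ e⟩
  refine (expect_pow_counts_le hc ha hl a e (by linarith) hn).trans ?_
  have hnet := net_flow_ge hc hca ha hl hn a e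
  have hO : ∑ g, flow c amax lam n (counts n a) e g ≤ lam * counts n a e := by
    rw [sum_flow_out, mul_comm]
    exact mul_le_mul_of_nonneg_right (sum_rate_le hc hl hn a e) (Nat.cast_nonneg _)
  have hI : 0 ≤ ∑ g, flow c amax lam n (counts n a) g e :=
    Finset.sum_nonneg fun g _ => flow_nonneg hc ha hl _ g e
  set x := counts n a e with hx
  set A := ∑ f, (c f)⁻¹ with hAdef
  have hx0 : (0 : ℝ) ≤ x := Nat.cast_nonneg x
  by_cases hlow : 2 * (c e * x * A) ≤ n
  · have h1 : 1 / 4 ≤ 1 - (c e * x + 2 * amax) * A / n := by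
      have : (c e * x + 2 * amax) * A / n ≤ 3 / 4 := by
        rw [div_le_iff₀ hn']; nlinarith
      linarith
    have h2 := mul_le_mul_of_nonneg_left h1 (mul_nonneg hl hx0)
    have h3 : Real.exp ((∑ g, flow c amax lam n (counts n a) e g) / 4
          - (∑ g, flow c amax lam n (counts n a) g e) / 5) ≤ 1 :=
      Real.exp_le_one_iff.2 (by linarith)
    have h4 := mul_le_mul_of_nonneg_left h3 (by positivity : (0 : ℝ) ≤ (4 / 5 : ℝ) ^ x)
    have h5 : 0 ≤ lam * (4 * Real.exp (-((n : ℝ) / (A * c e)) / 32)) := by positivity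
    linarith
  · push Not at hlow
    have h1 : Real.exp ((∑ g, flow c amax lam n (counts n a) e g) / 4
          - (∑ g, flow c amax lam n (counts n a) g e) / 5) ≤ Real.exp (lam * x / 4) :=
      Real.exp_le_exp.2 (by linarith)
    refine (mul_le_mul_of_nonneg_left h1 (by positivity)).trans
      ((pow_mul_exp_le x hl hl1).trans ?_)
    have h2 : (n : ℝ) / (A * c e) ≤ 2 * x := by
      rw [div_le_iff₀ (by positivity)]; nlinarith
    have h3 : Real.exp (-(x : ℝ) / 16) ≤ Real.exp (-((n : ℝ) / (A * c e)) / 32) :=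
      Real.exp_le_exp.2 (by linarith)
    have h4 := mul_le_mul_of_nonneg_left h3 hl
    linarith

end Round

/-! ### Social cost and the stopped process -/

section Cost

variable {m n : ℕ} {c : Fin m → ℝ} {amax lam : ℝ}

lemma quadPot_nonneg (hc : ∀ e, 0 < c e) (x : Fin m → ℕ) : 0 ≤ quadPot c x :=
  Finset.sum_nonneg fun e _ => mul_nonneg (hc e).le (sq_nonneg _)

lemma quadPot_le (hca : ∀ e, c e ≤ amax) (ha : 0 < amax)
    (a : Fin n → Fin m) : quadPot c (counts n a) ≤ amax * (n : ℝ) ^ 2 := by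
  have h1 : ∀ e, (counts n a e : ℝ) ≤ n := by
    intro e
    rw [← sum_counts a]
    exact Finset.single_le_sum (f := fun e => (counts n a e : ℝ))
      (fun _ _ => Nat.cast_nonneg _) (Finset.mem_univ e)
  calc quadPot c (counts n a) ≤ ∑ e, amax * n * (counts n a e : ℝ) := by
        refine Finset.sum_le_sum fun e _ => ?_
        have h0 : (0 : ℝ) ≤ counts n a e := Nat.cast_nonneg _
        calc c e * (counts n a e : ℝ) ^ 2 ≤ amax * (counts n a e : ℝ) ^ 2 :=
              mul_le_mul_of_nonneg_right (hca e) (sq_nonneg _)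
          _ = amax * (counts n a e : ℝ) * counts n a e := by ring
          _ ≤ amax * n * counts n a e := by
              have := h1 e
              gcongr
    _ = _ := by rw [← Finset.mul_sum, sum_counts]; ring

lemma SC_eq_quadPot_div (x : Fin m → ℕ) : SC n c x = quadPot c x / n := by
  rw [SC, quadPot, Finset.sum_div]
  exact Finset.sum_congr rfl fun e _ => by ring

lemma SC_le (hca : ∀ e, c e ≤ amax) (ha : 0 < amax) (hn : 0 < n) (a : Fin n → Fin m) :
    SC n c (counts n a) ≤ n * amax := by
  have hn' : (0 : ℝ) < n := by exact_mod_cast hn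
  rw [SC_eq_quadPot_div, div_le_iff₀ hn']
  have := quadPot_le hca ha a
  nlinarith

/-- A stable state that uses every link is almost optimal. -/
lemma SC_le_of_stable [NeZero m] (hc : ∀ e, 0 < c e) (hca : ∀ e, c e ≤ amax) (hn : 0 < n)
    (a : Fin n → Fin m) (hst : IsImitationStable c amax (counts n a))
    (hpos : ∀ e, 0 < counts n a e) :
    SC n c (counts n a) ≤ n / (∑ f, (c f)⁻¹) + 2 * amax := by
  have hn' : (0 : ℝ) < n := by exact_mod_cast hn
  have hA : 0 < ∑ f, (c f)⁻¹ :=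
    Finset.sum_pos (fun f _ => inv_pos.2 (hc f)) Finset.univ_nonempty
  obtain ⟨f, hf⟩ : ∃ f, c f * counts n a f ≤ n / (∑ f, (c f)⁻¹) := by
    by_contra! h
    have h1 : ∑ f, n / (∑ f, (c f)⁻¹) * (c f)⁻¹ < ∑ f, (counts n a f : ℝ) := by
      refine Finset.sum_lt_sum_of_nonempty Finset.univ_nonempty fun f _ => ?_
      rw [← div_eq_mul_inv, div_lt_iff₀ (hc f), mul_comm (counts n a f : ℝ)]
      exact h f
    rw [← Finset.mul_sum, sum_counts, div_mul_cancel₀ _ hA.ne'] at h1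
    exact lt_irrefl _ h1
  have hL : ∀ e, c e * counts n a e ≤ n / (∑ f, (c f)⁻¹) + 2 * amax := by
    intro e
    have h1 := hst e f (hpos e) (hpos f)
    have h2 := hca f
    linarith
  calc SC n c (counts n a)
      ≤ ∑ e, (counts n a e : ℝ) / n * (n / (∑ f, (c f)⁻¹) + 2 * amax) :=
        Finset.sum_le_sum fun e _ => mul_le_mul_of_nonneg_left (hL e) (by positivity)
    _ = _ := by rw [← Finset.sum_mul, ← Finset.sum_div, sum_counts, div_self hn'.ne', one_mul]

/-- Bound on the expected cost of the stopped process in terms of the Lyapunov functions of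
the starting state. -/
lemma stoppedSC_le [NeZero m] (hc : ∀ e, 0 < c e) (hca : ∀ e, c e ≤ amax) (ha : 0 < amax)
    (hl : 0 < lam) (hl1 : lam ≤ 1 / 4) (hn : 0 < n)
    (hA : 8 * (amax * ∑ f, (c f)⁻¹) ≤ n) (T : ℕ) (a : Fin n → Fin m) :
    stoppedSC c amax lam n T a ≤ ENNReal.ofReal
      (n / (∑ f, (c f)⁻¹) + 2 * amax + n * amax * ∑ e, (4 / 5 : ℝ) ^ counts n a e
        + n * amax * (lam * (∑ e, 4 * Real.exp (-((n : ℝ) / ((∑ f, (c f)⁻¹) * c e)) / 32))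
            + (1 - lam / (2 * (n : ℝ) ^ 3)) ^ T)
          * (2 * n / (lam * amax) * quadPot c (counts n a))) := by
  have hn' : (0 : ℝ) < n := by exact_mod_cast hn
  have hn1 : (1 : ℝ) ≤ n := by exact_mod_cast hn
  have hApos : 0 < ∑ f, (c f)⁻¹ :=
    Finset.sum_pos (fun f _ => inv_pos.2 (hc f)) Finset.univ_nonempty
  set M : ℝ := n / (∑ f, (c f)⁻¹) + 2 * amax with hM
  set ε : ℝ := ∑ e, 4 * Real.exp (-((n : ℝ) / ((∑ f, (c f)⁻¹) * c e)) / 32) with hε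
  set ρ : ℝ := 1 - lam / (2 * (n : ℝ) ^ 3) with hρ
  set B : ℝ := n * amax with hB
  set H : (Fin n → Fin m) → ℝ := fun a => ∑ e, (4 / 5 : ℝ) ^ counts n a e with hH
  set Ψ : (Fin n → Fin m) → ℝ := fun a => 2 * n / (lam * amax) * quadPot c (counts n a) with hΨ
  change stoppedSC c amax lam n T a
    ≤ ENNReal.ofReal (M + B * H a + B * (lam * ε + ρ ^ T) * Ψ a)
  have hM0 : 0 ≤ M := by positivity
  have hB0 : 0 ≤ B := by positivity
  have hε0 : 0 ≤ ε := Finset.sum_nonneg fun e _ => by positivity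
  have hH0 : ∀ a, 0 ≤ H a := fun a => Finset.sum_nonneg fun e _ => by positivity
  have hΨ0 : ∀ a, 0 ≤ Ψ a := fun a => mul_nonneg (by positivity) (quadPot_nonneg hc _)
  have hρ0 : 0 ≤ ρ := by
    have h1 : lam / (2 * (n : ℝ) ^ 3) ≤ 1 := by
      rw [div_le_one (by positivity)]
      have := one_le_pow₀ hn1 (n := 3)
      linarith
    linarith
  have hp0 := fun a a' : Fin n → Fin m =>
    roundProb_nonneg hc ha hl.le (by linarith : lam ≤ 1) hn a a'
  have hΨdrop : ∀ a, ¬ IsImitationStable c amax (counts n a) →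
      ∑ a', roundProb c amax lam n a a' * Ψ a' ≤ Ψ a - 1 := by
    intro a hst
    have h1 := expect_quadPot_le hc hca ha hl.le hl1 hn a hst
    have h2 := mul_le_mul_of_nonneg_left h1 (by positivity : 0 ≤ 2 * n / (lam * amax))
    calc ∑ a', roundProb c amax lam n a a' * Ψ a'
        = 2 * n / (lam * amax) * ∑ a', roundProb c amax lam n a a' * quadPot c (counts n a') := by
          rw [Finset.mul_sum]
          exact Finset.sum_congr rfl fun _ _ => by rw [hΨ]; ring
      _ ≤ _ := h2
      _ = Ψ a - 1 := by rw [hΨ]; field_simp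
  have hHdrift : ∀ a, ∑ a', roundProb c amax lam n a a' * H a' ≤ H a + lam * ε := by
    intro a
    calc ∑ a', roundProb c amax lam n a a' * H a'
        = ∑ e, ∑ a', roundProb c amax lam n a a' * (4 / 5 : ℝ) ^ counts n a' e := by
          simp only [hH, Finset.mul_sum]
          rw [Finset.sum_comm]
      _ ≤ ∑ e, ((4 / 5 : ℝ) ^ counts n a e
            + lam * (4 * Real.exp (-((n : ℝ) / ((∑ f, (c f)⁻¹) * c e)) / 32))) :=
          Finset.sum_le_sum fun e _ => expect_weight_le hc hca ha hl.le hl1 hn hA a e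
      _ = H a + lam * ε := by rw [Finset.sum_add_distrib, ← Finset.mul_sum]
  have hρΨ : ∀ a, Ψ a - 1 ≤ ρ * Ψ a := by
    intro a
    have h1 := quadPot_le hca ha a
    have h2 : lam / (2 * (n : ℝ) ^ 3) * Ψ a ≤ 1 := by
      calc lam / (2 * (n : ℝ) ^ 3) * Ψ a
          = quadPot c (counts n a) / (amax * (n : ℝ) ^ 2) := by rw [hΨ]; field_simp
        _ ≤ 1 := div_le_one_of_le₀ h1 (by positivity)
    rw [hρ]; linarith
  have hstable : ∀ T a, IsImitationStable c amax (counts n a) →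
      SC n c (counts n a) ≤ M + B * H a + B * (lam * ε + ρ ^ T) * Ψ a := by
    intro T a hst
    have h3 : 0 ≤ B * (lam * ε + ρ ^ T) * Ψ a :=
      mul_nonneg (by positivity) (hΨ0 a)
    by_cases hpos : ∀ e, 0 < counts n a e
    · have h1 := SC_le_of_stable hc hca hn a hst hpos
      have h2 := mul_nonneg hB0 (hH0 a)
      linarith
    · push Not at hpos
      obtain ⟨e, he⟩ := hpos
      have h1 := SC_le hca ha hn a
      have h2 : 1 ≤ H a := by
        have h4 := Finset.single_le_sum (f := fun e => (4 / 5 : ℝ) ^ counts n a e)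
          (fun _ _ => by positivity) (Finset.mem_univ e)
        have h5 : counts n a e = 0 := by omega
        simpa [h5] using h4
      have h4 := mul_le_mul_of_nonneg_left h2 hB0
      linarith
  induction T generalizing a with
  | zero =>
    rw [stoppedSC]
    refine ENNReal.ofReal_le_ofReal ?_
    by_cases hst : IsImitationStable c amax (counts n a)
    · exact hstable 0 a hst
    · have h1 : 1 ≤ Ψ a := by
        have h2 := hΨdrop a hst
        have h3 : 0 ≤ ∑ a', roundProb c amax lam n a a' * Ψ a' :=
          Finset.sum_nonneg fun a' _ => mul_nonneg (hp0 a a') (hΨ0 a')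
        linarith
      have h2 := SC_le hca ha hn a
      have h3 := mul_nonneg hB0 (hH0 a)
      have h4 : B ≤ B * (lam * ε + ρ ^ 0) * Ψ a := by
        have h5 : (1 : ℝ) ≤ lam * ε + ρ ^ 0 := by
          rw [pow_zero]; nlinarith
        calc B = B * 1 * 1 := by ring
          _ ≤ _ := by gcongr
      linarith
  | succ T ih =>
    rw [stoppedSC]
    split_ifs with hst
    · exact ENNReal.ofReal_le_ofReal (hstable (T + 1) a hst)
    · have hU0 : ∀ a, 0 ≤ M + B * H a + B * (lam * ε + ρ ^ T) * Ψ a := by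
        intro a
        have := hH0 a
        have := hΨ0 a
        positivity
      calc ∑ a', ENNReal.ofReal (roundProb c amax lam n a a') * stoppedSC c amax lam n T a'
          ≤ ∑ a', ENNReal.ofReal (roundProb c amax lam n a a' *
              (M + B * H a' + B * (lam * ε + ρ ^ T) * Ψ a')) := by
            refine Finset.sum_le_sum fun a' _ => ?_
            rw [ENNReal.ofReal_mul (hp0 a a')]
            exact mul_le_mul_right (ih a') _
        _ = ENNReal.ofReal (∑ a', roundProb c amax lam n a a' *
              (M + B * H a' + B * (lam * ε + ρ ^ T) * Ψ a')) :=
            (ENNReal.ofReal_sum_of_nonneg fun a' _ => mul_nonneg (hp0 a a') (hU0 a')).symm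
        _ ≤ _ := by
            refine ENNReal.ofReal_le_ofReal ?_
            have h1 : ∑ a', roundProb c amax lam n a a' *
                (M + B * H a' + B * (lam * ε + ρ ^ T) * Ψ a')
                = M * ∑ a', roundProb c amax lam n a a'
                  + B * ∑ a', roundProb c amax lam n a a' * H a'
                  + B * (lam * ε + ρ ^ T) * ∑ a', roundProb c amax lam n a a' * Ψ a' := by
              simp only [Finset.mul_sum, ← Finset.sum_add_distrib]
              exact Finset.sum_congr rfl fun _ _ => by ring
            rw [h1, sum_roundProb hc ha]
            have h2 := mul_le_mul_of_nonneg_left (hHdrift a) hB0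
            have h3 := mul_le_mul_of_nonneg_left (hΨdrop a hst)
              (by positivity : 0 ≤ B * (lam * ε + ρ ^ T))
            have h4 := mul_le_mul_of_nonneg_left (hρΨ a) (by positivity : 0 ≤ B * ρ ^ T)
            rw [pow_succ]
            nlinarith

/-- Under uniformly random initialization every link is populated with high probability. -/
lemma expect_weight_uniform_le [NeZero m] (e : Fin m) :
    ∑ a : Fin n → Fin m, 1 / (m : ℝ) ^ n * (4 / 5 : ℝ) ^ counts n a e
      ≤ Real.exp (-((n : ℝ) / m) / 5) := by
  have hm : (0 : ℝ) < m := by exact_mod_cast Nat.pos_of_ne_zero (NeZero.ne m)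
  have hm1 : (1 : ℝ) ≤ m := by exact_mod_cast Nat.pos_of_ne_zero (NeZero.ne m)
  have h := expect_pow_counts (n := n) (fun _ (_ : Fin m) => 1 / (m : ℝ))
    (fun _ => by simp [hm.ne']) (4 / 5) e
  simp only [Finset.prod_const, Finset.card_univ, Fintype.card_fin, div_pow, one_pow] at h
  simp only [div_pow]
  rw [h]
  have h1 : 0 ≤ 1 - 1 / (m : ℝ) * (1 - 4 / 5) := by
    have : 1 / (m : ℝ) ≤ 1 := by rw [div_le_one hm]; exact hm1
    linarith
  calc (1 - 1 / (m : ℝ) * (1 - 4 / 5)) ^ n ≤ Real.exp (-(1 / (m : ℝ) / 5)) ^ n := by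
        refine pow_le_pow_left₀ h1 ?_ n
        have := Real.add_one_le_exp (-(1 / (m : ℝ) / 5))
        linarith
    _ = _ := by rw [← Real.exp_nat_mul]; congr 1; ring

/-- Bound on the expected cost after `T` rounds from a uniformly random initialization. -/
lemma expect_stoppedSC_le [NeZero m] (hc : ∀ e, 0 < c e) (hca : ∀ e, c e ≤ amax)
    (ha : 0 < amax) (hl : 0 < lam) (hl1 : lam ≤ 1 / 4) (hn : 0 < n)
    (hA : 8 * (amax * ∑ f, (c f)⁻¹) ≤ n) (T : ℕ) :
    ∑ a : Fin n → Fin m, ENNReal.ofReal (1 / (m : ℝ) ^ n) * stoppedSC c amax lam n T a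
      ≤ ENNReal.ofReal
      (n / (∑ f, (c f)⁻¹) + 2 * amax + n * amax * (m * Real.exp (-((n : ℝ) / m) / 5))
        + n * amax * (lam * (∑ e, 4 * Real.exp (-((n : ℝ) / ((∑ f, (c f)⁻¹) * c e)) / 32))
            + (1 - lam / (2 * (n : ℝ) ^ 3)) ^ T) * (2 * (n : ℝ) ^ 3 / lam)) := by
  have hn' : (0 : ℝ) < n := by exact_mod_cast hn
  have hn1 : (1 : ℝ) ≤ n := by exact_mod_cast hn
  have hm : (0 : ℝ) < m := by exact_mod_cast Nat.pos_of_ne_zero (NeZero.ne m)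
  have hApos : 0 < ∑ f, (c f)⁻¹ :=
    Finset.sum_pos (fun f _ => inv_pos.2 (hc f)) Finset.univ_nonempty
  set M : ℝ := n / (∑ f, (c f)⁻¹) + 2 * amax with hM
  set ε : ℝ := ∑ e, 4 * Real.exp (-((n : ℝ) / ((∑ f, (c f)⁻¹) * c e)) / 32) with hε
  set ρ : ℝ := 1 - lam / (2 * (n : ℝ) ^ 3) with hρ
  set P : ℝ := 2 * (n : ℝ) ^ 3 / lam with hP
  have hρ0 : 0 ≤ ρ := by
    have h1 : lam / (2 * (n : ℝ) ^ 3) ≤ 1 := by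
      rw [div_le_one (by positivity)]
      have := one_le_pow₀ hn1 (n := 3)
      linarith
    linarith
  have hM0 : 0 ≤ M := by positivity
  have hε0 : 0 ≤ ε := Finset.sum_nonneg fun e _ => by positivity
  have hP0 : 0 ≤ P := by positivity
  have hq : ∀ a : Fin n → Fin m, stoppedSC c amax lam n T a ≤ ENNReal.ofReal
      (M + n * amax * ∑ e, (4 / 5 : ℝ) ^ counts n a e + n * amax * (lam * ε + ρ ^ T) * P) := by
    intro a
    refine (stoppedSC_le hc hca ha hl hl1 hn hA T a).trans (ENNReal.ofReal_le_ofReal ?_)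
    have h1 : 2 * n / (lam * amax) * quadPot c (counts n a) ≤ P := by
      calc 2 * n / (lam * amax) * quadPot c (counts n a)
          ≤ 2 * n / (lam * amax) * (amax * (n : ℝ) ^ 2) :=
            mul_le_mul_of_nonneg_left (quadPot_le hca ha a) (by positivity)
        _ = P := by rw [hP]; field_simp
    have h2 := mul_le_mul_of_nonneg_left h1
      (by positivity : 0 ≤ n * amax * (lam * ε + ρ ^ T))
    linarith
  have hU0 : ∀ a : Fin n → Fin m, 0 ≤ 1 / (m : ℝ) ^ n *
      (M + n * amax * ∑ e, (4 / 5 : ℝ) ^ counts n a e + n * amax * (lam * ε + ρ ^ T) * P) := by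
    intro a
    have : 0 ≤ ∑ e, (4 / 5 : ℝ) ^ counts n a e := Finset.sum_nonneg fun e _ => by positivity
    positivity
  calc ∑ a : Fin n → Fin m, ENNReal.ofReal (1 / (m : ℝ) ^ n) * stoppedSC c amax lam n T a
      ≤ ∑ a : Fin n → Fin m, ENNReal.ofReal (1 / (m : ℝ) ^ n *
        (M + n * amax * ∑ e, (4 / 5 : ℝ) ^ counts n a e + n * amax * (lam * ε + ρ ^ T) * P)) := by
        refine Finset.sum_le_sum fun a _ => ?_
        rw [ENNReal.ofReal_mul (by positivity)]
        exact mul_le_mul_right (hq a) _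
    _ = ENNReal.ofReal (∑ a : Fin n → Fin m, 1 / (m : ℝ) ^ n *
        (M + n * amax * ∑ e, (4 / 5 : ℝ) ^ counts n a e + n * amax * (lam * ε + ρ ^ T) * P)) :=
        (ENNReal.ofReal_sum_of_nonneg fun a _ => hU0 a).symm
    _ ≤ _ := by
        refine ENNReal.ofReal_le_ofReal ?_
        have h1 : ∑ _a : Fin n → Fin m, 1 / (m : ℝ) ^ n = 1 := by
          simp [hm.ne']
        have h2 : ∑ a : Fin n → Fin m, 1 / (m : ℝ) ^ n * ∑ e, (4 / 5 : ℝ) ^ counts n a e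
            ≤ m * Real.exp (-((n : ℝ) / m) / 5) := by
          simp only [Finset.mul_sum]
          rw [Finset.sum_comm]
          refine (Finset.sum_le_sum fun e _ => expect_weight_uniform_le e).trans (le_of_eq ?_)
          simp
        have h3 : ∑ a : Fin n → Fin m, 1 / (m : ℝ) ^ n *
            (M + n * amax * ∑ e, (4 / 5 : ℝ) ^ counts n a e + n * amax * (lam * ε + ρ ^ T) * P)
            = (M + n * amax * (lam * ε + ρ ^ T) * P) * ∑ _a : Fin n → Fin m, 1 / (m : ℝ) ^ n
              + n * amax * ∑ a : Fin n → Fin m,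
                1 / (m : ℝ) ^ n * ∑ e, (4 / 5 : ℝ) ^ counts n a e := by
          clear_value ε
          rw [Finset.mul_sum, Finset.mul_sum, ← Finset.sum_add_distrib]
          exact Finset.sum_congr rfl fun _ _ => by ring
        rw [h3, h1]
        have h4 := mul_le_mul_of_nonneg_left h2 (by positivity : 0 ≤ n * amax)
        linarith

end Cost

/-- There are constants `K` (the hidden constant of the `Ω(log n)`
assumption) and `λ₀ > 0` such that for every `δ > 0` there is an `n₀(δ)` (independent of
the instance) with: for all `n ≥ n₀(δ)` and every singleton congestion game with linear
latency functions `ℓ_e(x) = a_e·x` whose optimal fractional congestions satisfy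
`n/(A_Γ·a_e) ≥ K·log n`, the expected social cost `I_Γ` of the state to which the
Imitation Protocol (with `0 < λ ≤ λ₀`, uniformly random initialization) converges
satisfies `I_Γ ≤ (3+δ)·n/A_Γ`. -/
theorem price_of_imitation :
    ∃ K lam0 : ℝ, 0 < K ∧ 0 < lam0 ∧
      ∀ δ : ℝ, 0 < δ → ∃ n₀ : ℕ, ∀ n : ℕ, n₀ ≤ n →
        ∀ (m : ℕ) (c : Fin m → ℝ) (amax lam : ℝ),
          (∀ e, 0 < c e) →
          IsGreatest (Set.range c) amax →
          (∀ e, K * Real.log n ≤ (n : ℝ) / ((∑ f, (c f)⁻¹) * c e)) →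
          0 < lam → lam ≤ lam0 →
          Filter.limsup
              (fun T => ∑ a : Fin n → Fin m,
                ENNReal.ofReal (1 / (m : ℝ) ^ n) * stoppedSC c amax lam n T a)
              Filter.atTop ≤
            ENNReal.ofReal ((3 + δ) * n / (∑ f, (c f)⁻¹)) := by
  refine ⟨256, 1 / 4, by norm_num, by norm_num, fun δ hδ => ⟨3, ?_⟩⟩
  intro n hn3 m c amax lam hc hmax hopt hl hl1
  obtain ⟨⟨e₀, he₀⟩, hub⟩ := hmax
  have hca : ∀ e, c e ≤ amax := fun e => hub ⟨e, rfl⟩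
  have ha : 0 < amax := he₀ ▸ hc e₀
  have : NeZero m := ⟨by rintro rfl; exact e₀.elim0⟩
  have hn : 0 < n := by omega
  have hn' : (0 : ℝ) < n := by exact_mod_cast hn
  have hn3' : (3 : ℝ) ≤ n := by exact_mod_cast hn3
  have hm : (0 : ℝ) < m := by exact_mod_cast Nat.pos_of_ne_zero (NeZero.ne m)
  have hlog : 1 ≤ Real.log n := by
    rw [Real.le_log_iff_exp_le hn']
    linarith [Real.exp_one_lt_d9]
  have hexp : ∀ k : ℕ, Real.exp (-(k * Real.log n)) = ((n : ℝ) ^ k)⁻¹ := by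
    intro k
    rw [Real.exp_neg, Real.exp_nat_mul, Real.exp_log hn']
  have hApos : 0 < ∑ f, (c f)⁻¹ :=
    Finset.sum_pos (fun f _ => inv_pos.2 (hc f)) Finset.univ_nonempty
  set A := ∑ f, (c f)⁻¹ with hAdef
  have hA : 8 * (amax * A) ≤ n := by
    have h1 := hopt e₀
    rw [he₀, le_div_iff₀ (by positivity)] at h1
    have : 0 < A * amax := by positivity
    nlinarith
  have hmK : m * (256 * Real.log n) ≤ n := by
    have h1 := Finset.sum_le_sum fun e (_ : e ∈ (Finset.univ : Finset (Fin m))) => hopt e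
    have h2 : ∑ e, (n : ℝ) / (A * c e) = n := by
      have h3 : ∀ e, (n : ℝ) / (A * c e) = n / A * (c e)⁻¹ := fun e => by
        rw [← div_div, div_eq_mul_inv (n / A : ℝ)]
      simp only [h3, ← Finset.mul_sum]
      rw [← hAdef, div_mul_cancel₀ _ hApos.ne']
    rw [h2] at h1
    simpa using h1
  have hmn : (m : ℝ) ≤ n := by nlinarith
  set L : ℝ := n / A with hL
  have hLpos : 0 < L := by positivity
  have haL : amax ≤ L / 8 := by
    rw [hL, div_div, le_div_iff₀ (by positivity)]
    linarith
  have hB : n * amax ≤ n * (L / 8) := mul_le_mul_of_nonneg_left haL hn'.le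
  have hstart : n * amax * (m * Real.exp (-((n : ℝ) / m) / 5)) ≤ L / 8 := by
    have h1 : Real.exp (-((n : ℝ) / m) / 5) ≤ ((n : ℝ) ^ 2)⁻¹ := by
      rw [← hexp 2]
      refine Real.exp_le_exp.2 ?_
      have : 256 * Real.log n ≤ n / m := by
        rw [le_div_iff₀ hm]; linarith
      push_cast
      linarith
    calc n * amax * (m * Real.exp (-((n : ℝ) / m) / 5))
        ≤ n * (L / 8) * (n * ((n : ℝ) ^ 2)⁻¹) := by gcongr
      _ = L / 8 := by field_simp
  have hleak : n * amax * (lam * ∑ e, 4 * Real.exp (-((n : ℝ) / (A * c e)) / 32))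
      * (2 * (n : ℝ) ^ 3 / lam) ≤ L := by
    have h1 : ∑ e, 4 * Real.exp (-((n : ℝ) / (A * c e)) / 32) ≤ n * (4 * ((n : ℝ) ^ 8)⁻¹) := by
      calc ∑ e, 4 * Real.exp (-((n : ℝ) / (A * c e)) / 32)
          ≤ ∑ _e : Fin m, 4 * ((n : ℝ) ^ 8)⁻¹ := by
            refine Finset.sum_le_sum fun e _ => mul_le_mul_of_nonneg_left ?_ (by norm_num)
            rw [← hexp 8]
            refine Real.exp_le_exp.2 ?_
            have := hopt e
            push_cast
            linarith
        _ = m * (4 * ((n : ℝ) ^ 8)⁻¹) := by simp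
        _ ≤ _ := by gcongr
    have h2 : 0 ≤ ∑ e, 4 * Real.exp (-((n : ℝ) / (A * c e)) / 32) :=
      Finset.sum_nonneg fun e _ => by positivity
    calc n * amax * (lam * ∑ e, 4 * Real.exp (-((n : ℝ) / (A * c e)) / 32))
          * (2 * (n : ℝ) ^ 3 / lam)
        ≤ n * (L / 8) * (lam * (n * (4 * ((n : ℝ) ^ 8)⁻¹))) * (2 * (n : ℝ) ^ 3 / lam) := by
          gcongr
      _ = L * ((n : ℝ) ^ 3)⁻¹ := by field_simp; norm_num
      _ ≤ L := mul_le_of_le_one_right hLpos.le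
          (inv_le_one_of_one_le₀ (one_le_pow₀ (by linarith)))
  have hpow : Filter.Tendsto (fun T : ℕ => n * amax * (1 - lam / (2 * (n : ℝ) ^ 3)) ^ T
      * (2 * (n : ℝ) ^ 3 / lam)) Filter.atTop (nhds 0) := by
    have h1 : 0 < lam / (2 * (n : ℝ) ^ 3) := by positivity
    have h2 : lam / (2 * (n : ℝ) ^ 3) ≤ 1 := by
      rw [div_le_one (by positivity)]
      have := one_le_pow₀ (by linarith : (1 : ℝ) ≤ n) (n := 3)
      linarith
    have h3 := tendsto_pow_atTop_nhds_zero_of_lt_one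
      (by linarith : 0 ≤ 1 - lam / (2 * (n : ℝ) ^ 3)) (by linarith)
    simpa using (h3.const_mul (n * amax)).mul_const (2 * (n : ℝ) ^ 3 / lam)
  refine Filter.limsup_le_of_le (h := ?_)
  filter_upwards [hpow.eventually_lt_const (by positivity : 0 < L / 2)] with T hT
  refine (expect_stoppedSC_le hc hca ha hl hl1 hn hA T).trans (ENNReal.ofReal_le_ofReal ?_)
  have hgoal : (3 + δ) * n / A = 3 * L + δ * L := by rw [hL]; ring
  have hδL : 0 < δ * L := by positivity
  rw [hgoal]
  linarith

end Stmt13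
end
end
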